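/- arXiv:1307.4604 — 11 statements merged into one kernel-verified Lean document; each statement's English description precedes it below -/
import Mathlib

section
/- For every real number r ≥ 1 and every t with 0 < t < 1 and r·t ≥ 50, setting Φ = ∫₀^{r^{1/2}/3} e^{−u²·t} du, one has |Φ^{−1} − (4/π)^{1/2}·t^{1/2}| ≤ 6·r^{−1/2}·e^{−r·t/9}, and moreover (1/10)·t^{1/2} ≤ Φ^{−1} ≤ 10·t^{1/2}. -/
open MeasureTheory Real

/-- Chernoff-type bound on the Gaussian tail, from `u ^ 2 ≥ 2 * L * u - L ^ 2`. -/
lemma integral_gaussian_Ioi_le {b L : ℝ} (hb : 0 < b) (hL : 0 < L) :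
    ∫ u in Set.Ioi L, Real.exp (-b * u ^ 2) ≤ Real.exp (-b * L ^ 2) / (2 * b * L) := by
  have hneg : -(2 * b * L) < 0 := by
    have : 0 < 2 * b * L := by positivity
    linarith
  have hint : IntegrableOn (fun u : ℝ => Real.exp (-(2 * b * L) * u)) (Set.Ioi L) :=
    integrableOn_exp_mul_Ioi hneg L
  calc ∫ u in Set.Ioi L, Real.exp (-b * u ^ 2)
      ≤ ∫ u in Set.Ioi L, Real.exp (b * L ^ 2) * Real.exp (-(2 * b * L) * u) := by
        refine setIntegral_mono (integrable_exp_neg_mul_sq hb).integrableOn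
          (hint.const_mul _) fun u => ?_
        simp only [← Real.exp_add]
        refine Real.exp_le_exp.2 ?_
        nlinarith [mul_nonneg hb.le (sq_nonneg (u - L))]
    _ = Real.exp (-b * L ^ 2) / (2 * b * L) := by
        rw [integral_const_mul, integral_exp_mul_Ioi hneg, neg_div_neg_eq, ← mul_div_assoc,
          ← Real.exp_add]
        congr 2
        ring

/-- Lemma 5.1: bounds on the reciprocal of the truncated Gaussian integral
`Φ = ∫₀^{√r/3} e^{-u²t} du` when `r ≥ 1`, `0 < t < 1` and `r·t ≥ 50`. -/
theorem stmt0 (r t Φ : ℝ) (hr : 1 ≤ r) (ht0 : 0 < t) (ht1 : t < 1) (hrt : 50 ≤ r * t)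
    (hΦ : Φ = ∫ u in (0:ℝ)..(Real.sqrt r / 3), Real.exp (-u ^ 2 * t)) :
    |Φ⁻¹ - Real.sqrt (4 / Real.pi) * Real.sqrt t| ≤
        6 * r ^ (-(1:ℝ)/2) * Real.exp (-(r * t) / 9) ∧
    (1/10) * Real.sqrt t ≤ Φ⁻¹ ∧ Φ⁻¹ ≤ 10 * Real.sqrt t := by
  have hr0 : 0 < r := by linarith
  have hpow : r ^ (-(1:ℝ)/2) = (√r)⁻¹ := by
    rw [neg_div, Real.rpow_neg hr0.le, ← Real.sqrt_eq_rpow]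
  have hgauss := integral_gaussian_Ioi t
  have htail := integral_gaussian_Ioi_le ht0 (L := √r / 3) (by positivity)
  have htail0 : 0 ≤ ∫ u in Set.Ioi (√r / 3), Real.exp (-t * u ^ 2) :=
    integral_nonneg fun u => (Real.exp_pos _).le
  have hint : Integrable fun u : ℝ => Real.exp (-t * u ^ 2) := integrable_exp_neg_mul_sq ht0
  have hsplit := intervalIntegral.integral_interval_add_Ioi (a := 0) (b := √r / 3)
    hint.integrableOn hint.integrableOn
  have hΦ' : Φ = ∫ u in (0:ℝ)..(√r / 3), Real.exp (-t * u ^ 2) := by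
    rw [hΦ]
    congr 1
    ext u
    congr 1
    ring
  rw [← hΦ', hgauss] at hsplit
  have hexp : -t * (√r / 3) ^ 2 = -(r * t) / 9 := by
    rw [div_pow, Real.sq_sqrt hr0.le]
    ring
  rw [hexp] at htail
  rw [hpow]
  have hsπ : √(π / t) = √π / √t := Real.sqrt_div pi_pos.le t
  have hs4 : √(4 / π) = 2 / √π := by
    rw [Real.sqrt_div (by norm_num), show (4:ℝ) = 2 ^ 2 by norm_num, Real.sqrt_sq (by norm_num)]
  rw [hsπ] at hsplit
  rw [hs4]
  have hE0 : 0 < Real.exp (-(r * t) / 9) := Real.exp_pos _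
  have hE1 : Real.exp (-(r * t) / 9) ≤ 1 := Real.exp_le_one_iff.2 (by linarith)
  have hs : 0 < √r := Real.sqrt_pos.2 hr0
  have hq : 0 < √t := Real.sqrt_pos.2 ht0
  have hqq : √t ^ 2 = t := Real.sq_sqrt ht0.le
  have hp : 1.7 ≤ √π := Real.le_sqrt_of_sq_le (by linarith [pi_gt_three])
  have hp2 : √π ≤ 2 := Real.sqrt_le_iff.2 ⟨by norm_num, by linarith [pi_le_four]⟩
  have hsq : 7 ≤ √r * √t := by
    rw [← Real.sqrt_mul hr0.le]
    exact Real.le_sqrt_of_sq_le (by linarith)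
  generalize (∫ u in Set.Ioi (√r / 3), Real.exp (-t * u ^ 2)) = T at *
  generalize Real.exp (-(r * t) / 9) = E at *
  generalize √r = s at *
  generalize √t = q at *
  generalize √π = p at *
  have hp0 : 0 < p := by linarith
  have hT : T * (2 * q ^ 2 * s) ≤ 3 * E := by
    rw [le_div_iff₀ (by positivity), ← hqq] at htail
    linarith
  have hqΦ : q * Φ + q * T = p / 2 := by
    rw [← mul_add, hsplit]
    field_simp
  have hqT0 : 0 ≤ q * T := by positivity
  have hqT : q * T ≤ 3 / 14 := by nlinarith
  have hqΦ_lo : 3 / 5 ≤ q * Φ := by linarith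
  have hΦ0 : 0 < Φ := pos_of_mul_pos_right (by linarith) hq.le
  have hdiff : Φ⁻¹ - 2 / p * q = 2 * (q * T) / (p * Φ) := by
    field_simp
    linarith
  refine ⟨?_, ?_, ?_⟩
  · rw [hdiff, abs_of_nonneg (by positivity), div_le_iff₀ (by positivity)]
    have h1 : 1 ≤ p * (q * Φ) := by nlinarith
    have h2 : 2 * (q * T) * (q * s) ≤ 6 * E * (p * (q * Φ)) := by nlinarith
    have h3 : 2 * (q * T) ≤ 6 * E * (p * (q * Φ)) / (q * s) := by
      rwa [le_div_iff₀ (by positivity)]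
    refine h3.trans_eq ?_
    field_simp
  · rw [← one_div, le_div_iff₀ hΦ0]
    linarith
  · rw [← one_div, div_le_iff₀ hΦ0]
    linarith
end

section
/- Let r ≥ 2 be a real number, set θ = ((log r)/r)^{1/2} and Θ = (1/3)·(log r)^{1/2}. Let J be a finite set, N a real number, and λ : J → ℝ a family with 0 ≤ λ_j ≤ (1/3)·r^{1/2} for every j ∈ J, such that for every natural number k the number of indices j with k ≤ λ_j < k+1 is at most N. Then ∑_{j∈J} ∫_{θ·λ_j}^{Θ} e^{−20 s²} ds ≤ N·( (1/4)·(π/5)^{1/2} + (1/40)·(r/log r)^{1/2} ). -/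
open MeasureTheory Real

theorem const_mul_integral_le_integral_id_mul {f : ℝ → ℝ} (hf : Continuous f)
    (hf0 : ∀ x, 0 ≤ f x) {a b : ℝ} (hab : a ≤ b) :
    a * ∫ s in a..b, f s ≤ ∫ s in a..b, s * f s := by
  rw [← intervalIntegral.integral_const_mul]
  apply intervalIntegral.integral_mono_on hab
    ((continuous_const.mul hf).intervalIntegrable _ _)
    ((continuous_id.mul hf).intervalIntegrable _ _)
  intro x hx
  exact mul_le_mul_of_nonneg_right hx.1 (hf0 x)

theorem mul_sum_integral_tail_le {f : ℝ → ℝ} (hf : Continuous f)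
    (hf0 : ∀ x, 0 ≤ f x) {t : ℝ} (ht : 0 ≤ t) (T : ℝ) (n : ℕ) :
    t * ∑ k ∈ Finset.range n, ∫ s in (t * ((k + 1 : ℕ) : ℝ))..T, f s
      ≤ (∫ s in (0 : ℝ)..(t * n), s * f s) + t * n * ∫ s in (t * n)..T, f s := by
  induction n with
  | zero => simp
  | succ n ih =>
    have hi : ∀ a b, IntervalIntegrable f volume a b := fun a b => hf.intervalIntegrable a b
    have hj : ∀ a b, IntervalIntegrable (fun s => s * f s) volume a b :=
      fun a b => (continuous_id.mul hf).intervalIntegrable a b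
    have hle : t * (n : ℝ) ≤ t * ((n + 1 : ℕ) : ℝ) := by
      push_cast; nlinarith
    have h1 := const_mul_integral_le_integral_id_mul hf hf0 hle
    have h2 := intervalIntegral.integral_add_adjacent_intervals
      (hi (t * n) (t * ((n + 1 : ℕ) : ℝ))) (hi _ T)
    have h3 := intervalIntegral.integral_add_adjacent_intervals
      (hj 0 (t * n)) (hj _ (t * ((n + 1 : ℕ) : ℝ)))
    rw [Finset.sum_range_succ, mul_add, ← h3]
    rw [← h2] at ih
    have h4 : t * ((n + 1 : ℕ) : ℝ) = t * n + t := by push_cast; ring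
    generalize (∫ s in (t * ((n + 1 : ℕ) : ℝ))..T, f s) = A at *
    rw [h4] at h1 ih ⊢
    linarith

theorem integral_id_mul_exp_neg_sq_le (T : ℝ) :
    ∫ s in (0 : ℝ)..T, s * Real.exp (-20 * s ^ 2) ≤ 1 / 40 := by
  have hd : ∀ x ∈ Set.uIcc 0 T, HasDerivAt (fun s : ℝ => -(1 / 40) * Real.exp (-20 * s ^ 2))
      (x * Real.exp (-20 * x ^ 2)) x := by
    intro x _
    have h := (((hasDerivAt_pow 2 x).const_mul (-20)).exp).const_mul (-(1 / 40) : ℝ)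
    refine h.congr_deriv ?_
    push_cast
    ring
  rw [intervalIntegral.integral_eq_sub_of_hasDerivAt hd
    (Continuous.intervalIntegrable (by fun_prop) _ _)]
  have h := Real.exp_pos (-20 * T ^ 2)
  rw [zero_pow two_ne_zero, mul_zero, Real.exp_zero]
  linarith

theorem integral_exp_neg_sq_le {T : ℝ} (hT : 0 ≤ T) :
    ∫ s in (0 : ℝ)..T, Real.exp (-20 * s ^ 2) ≤ (1 / 4) * Real.sqrt (Real.pi / 5) := by
  have h : (1 / 4) * Real.sqrt (Real.pi / 5)
      = ∫ s in Set.Ioi (0 : ℝ), Real.exp (-20 * s ^ 2) := by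
    rw [integral_gaussian_Ioi, show Real.pi / 5 = 2 ^ 2 * (Real.pi / 20) by ring,
      Real.sqrt_mul (by norm_num), Real.sqrt_sq (by norm_num)]
    ring
  rw [h, intervalIntegral.integral_of_le hT]
  exact setIntegral_mono_set (integrable_exp_neg_mul_sq (by norm_num)).integrableOn
    (Filter.Eventually.of_forall fun x => (Real.exp_pos _).le)
    (Set.Ioc_subset_Ioi_self.eventuallyLE)

theorem sum_integral_exp_tail_le {t : ℝ} (ht : 0 < t) {T : ℝ} (n : ℕ) (hn : t * n ≤ T) :
    ∑ k ∈ Finset.range (n + 1), ∫ s in (t * (k : ℝ))..T, Real.exp (-20 * s ^ 2)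
      ≤ (1 / 4) * Real.sqrt (Real.pi / 5) + (1 / 40) * t⁻¹ := by
  have hf : Continuous fun s : ℝ => Real.exp (-20 * s ^ 2) := by fun_prop
  have hf0 : ∀ s : ℝ, 0 ≤ Real.exp (-20 * s ^ 2) := fun s => (Real.exp_pos _).le
  have hj : ∀ a b, IntervalIntegrable (fun s : ℝ => s * Real.exp (-20 * s ^ 2)) volume a b :=
    fun a b => (continuous_id.mul hf).intervalIntegrable a b
  have h1 := mul_sum_integral_tail_le hf hf0 ht.le T n
  have h2 := const_mul_integral_le_integral_id_mul hf hf0 hn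
  have h3 := intervalIntegral.integral_add_adjacent_intervals (hj 0 (t * n)) (hj _ T)
  have h4 := integral_id_mul_exp_neg_sq_le T
  have h5 := integral_exp_neg_sq_le (T := T) (le_trans (by positivity) hn)
  rw [Finset.sum_range_succ', Nat.cast_zero, mul_zero, add_comm]
  refine add_le_add h5 ?_
  rw [← div_eq_mul_inv, le_div_iff₀ ht, mul_comm]
  linarith

/-- The abstract estimate from Theorem 5.6, bounding the spectral asymmetry sum of
small eigenvalues using the eigenvalue density bound. -/
theorem stmt3 {ι : Type*} (r : ℝ) (hr : 2 ≤ r)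
    (J : Finset ι) (N : ℝ) (lam : ι → ℝ)
    (hlam : ∀ j ∈ J, 0 ≤ lam j ∧ lam j ≤ (1/3) * Real.sqrt r)
    (hcount : ∀ k : ℕ,
      (({j : ι | j ∈ J ∧ (k : ℝ) ≤ lam j ∧ lam j < (k : ℝ) + 1}.ncard : ℝ)) ≤ N) :
    ∑ j ∈ J, ∫ s in (Real.sqrt (Real.log r / r) * lam j)..((1/3) * Real.sqrt (Real.log r)),
        Real.exp (-20 * s ^ 2)
      ≤ N * ((1/4) * Real.sqrt (Real.pi / 5) + (1/40) * Real.sqrt (r / Real.log r)) := by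
  have hlog : 0 < Real.log r := Real.log_pos (by linarith)
  have hr0 : 0 < r := by linarith
  have hN : 0 ≤ N := le_trans (Nat.cast_nonneg _) (hcount 0)
  have hinv : Real.sqrt (r / Real.log r) = (Real.sqrt (Real.log r / r))⁻¹ := by
    rw [← Real.sqrt_inv, inv_div]
  have ht : 0 < Real.sqrt (Real.log r / r) := Real.sqrt_pos.2 (by positivity)
  have hT : Real.sqrt (Real.log r / r) * ((1/3) * Real.sqrt r)
      = (1/3) * Real.sqrt (Real.log r) := by
    rw [Real.sqrt_div hlog.le]
    field_simp
  rw [hinv]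
  generalize Real.sqrt (Real.log r / r) = t at *
  generalize (1/3) * Real.sqrt (Real.log r) = T at *
  set R := (1/3) * Real.sqrt r with hR
  have hR0 : 0 ≤ R := by positivity
  set G : ℝ → ℝ := fun x => ∫ s in (t * x)..T, Real.exp (-20 * s ^ 2) with hG
  have hi : ∀ a b, IntervalIntegrable (fun s : ℝ => Real.exp (-20 * s ^ 2)) volume a b :=
    fun a b => Continuous.intervalIntegrable (by fun_prop) a b
  have hG0 : ∀ x, x ≤ R → 0 ≤ G x := fun x hx =>
    intervalIntegral.integral_nonneg (hT ▸ mul_le_mul_of_nonneg_left hx ht.le)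
      fun s _ => (Real.exp_pos _).le
  have hGanti : ∀ x y, x ≤ y → G y ≤ G x := fun x y hxy => by
    have h := intervalIntegral.integral_add_adjacent_intervals (hi (t * x) (t * y)) (hi _ T)
    have h0 : 0 ≤ ∫ s in (t * x)..(t * y), Real.exp (-20 * s ^ 2) :=
      intervalIntegral.integral_nonneg (mul_le_mul_of_nonneg_left hxy ht.le)
        fun s _ => (Real.exp_pos _).le
    simp only [hG]
    linarith
  have hmaps : ∀ j ∈ J, ⌊lam j⌋₊ ∈ Finset.range (⌊R⌋₊ + 1) := fun j hj =>
    Finset.mem_range.2 (Nat.lt_succ_of_le (Nat.floor_mono (hlam j hj).2))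
  have hfiber : ∀ k : ℕ, ((J.filter fun j => ⌊lam j⌋₊ = k).card : ℝ) ≤ N := fun k => by
    refine le_of_eq_of_le ?_ (hcount k)
    rw [← Set.ncard_coe_finset]
    congr 2
    ext j
    simp only [Finset.coe_filter, Set.mem_ofPred_eq]
    exact and_congr_right fun hj => Nat.floor_eq_iff (hlam j hj).1
  calc ∑ j ∈ J, G (lam j) ≤ ∑ j ∈ J, G (⌊lam j⌋₊ : ℝ) :=
        Finset.sum_le_sum fun j hj => hGanti _ _ (Nat.floor_le (hlam j hj).1)
    _ = ∑ k ∈ Finset.range (⌊R⌋₊ + 1), ((J.filter fun j => ⌊lam j⌋₊ = k).card : ℝ) * G k := by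
        rw [← Finset.sum_fiberwise_of_maps_to hmaps]
        refine Finset.sum_congr rfl fun k _ => ?_
        rw [← nsmul_eq_mul, ← Finset.sum_const]
        exact Finset.sum_congr rfl fun j hj => by rw [(Finset.mem_filter.1 hj).2]
    _ ≤ ∑ k ∈ Finset.range (⌊R⌋₊ + 1), N * G k := by
        refine Finset.sum_le_sum fun k hk => mul_le_mul_of_nonneg_right (hfiber k) (hG0 _ ?_)
        exact (Nat.le_floor_iff hR0).1 (Nat.lt_succ_iff.1 (Finset.mem_range.1 hk))
    _ = N * ∑ k ∈ Finset.range (⌊R⌋₊ + 1), G k := by rw [Finset.mul_sum]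
    _ ≤ N * ((1/4) * Real.sqrt (Real.pi / 5) + (1/40) * t⁻¹) :=
        mul_le_mul_of_nonneg_left (sum_integral_exp_tail_le ht _
          (hT ▸ mul_le_mul_of_nonneg_left (Nat.floor_le hR0) ht.le)) hN
end

section
/- There is a universal constant c > 0 with the following property. Let C ≥ 1 and r ≥ 200 be real numbers, let (λ_j)_{j∈ℕ} be a sequence of real numbers and (a_j)_{j∈ℕ} a sequence of nonnegative real numbers such that: (i) ∑_{j : |λ_j| < 10} a_j ≤ C·r; (ii) for every integer k with 100 ≤ k ≤ r/10, ∑_{j : λ_j² < k+1} a_j ≤ C·r·(k+1)^{1/2}; (iii) for every integer k with k > r/10, ∑_{j : λ_j² < k+1} a_j ≤ C·(k+1)^{3/2}. Then for every t > 0 the sum of nonnegative terms ∑_{j∈ℕ} e^{−2·λ_j²·t}·a_j (taken in [0,∞]) satisfies ∑_{j∈ℕ} e^{−2·λ_j²·t}·a_j ≤ c·C·( r + r·t^{−1/2} + t^{−3/2}·e^{−r·t/10} ). -/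
open MeasureTheory Real

lemma lintegral_rpow_mul_exp_neg {p t : ℝ} (hp : 0 < p) (ht : 0 < t) :
    ∫⁻ s in Set.Ioi (0:ℝ), ENNReal.ofReal (s ^ (p - 1) * Real.exp (-(t * s))) =
      ENNReal.ofReal (t ^ (-p) * Real.Gamma p) := by
  have h := Real.integral_rpow_mul_exp_neg_mul_Ioi hp ht
  have hpos : 0 < (1 / t) ^ p * Real.Gamma p := by
    have := Real.Gamma_pos_of_pos hp
    positivity
  have hint : Integrable (fun s : ℝ => s ^ (p - 1) * Real.exp (-(t * s)))
      (volume.restrict (Set.Ioi (0:ℝ))) := by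
    apply Integrable.of_integral_ne_zero
    rw [h]
    exact hpos.ne'
  rw [← ofReal_integral_eq_lintegral_ofReal hint, h, one_div, Real.inv_rpow ht.le,
    Real.rpow_neg ht.le]
  filter_upwards [self_mem_ae_restrict measurableSet_Ioi] with s hs
  have : (0:ℝ) < s := hs
  positivity

lemma lintegral_Ioi_mul_exp_neg {t : ℝ} (ht : 0 < t) (x : ℝ) :
    ∫⁻ s in Set.Ioi x, ENNReal.ofReal (2 * t * Real.exp (-2 * s * t)) =
      ENNReal.ofReal (Real.exp (-2 * x * t)) := by
  have e : (fun s : ℝ => 2 * t * Real.exp (-2 * s * t)) =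
      fun s => 2 * t * Real.exp ((-2 * t) * s) := by
    funext s; ring_nf
  have hn : -2 * t < 0 := by linarith
  rw [← ofReal_integral_eq_lintegral_ofReal]
  · rw [e, integral_const_mul, integral_exp_mul_Ioi hn]
    congr 1
    field_simp
  · rw [e]
    exact (integrableOn_exp_mul_Ioi hn x).const_mul _
  · exact Filter.Eventually.of_forall fun s => by positivity

/-- Layer-cake form of a Laplace-type sum. -/
lemma tsum_exp_mul_eq_lintegral {t : ℝ} (ht : 0 < t) (x a : ℕ → ℝ) (hx : ∀ j, 0 ≤ x j) :
    ∑' j, ENNReal.ofReal (Real.exp (-2 * x j * t) * a j) =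
      ∫⁻ s in Set.Ioi (0:ℝ), ENNReal.ofReal (2 * t * Real.exp (-2 * s * t)) *
        ∑' j : {j // x j < s}, ENNReal.ofReal (a j.1) := by
  have hsub (s : ℝ) : ∑' j : {j // x j < s}, ENNReal.ofReal (a j.1) =
      ∑' j, (Set.Ioi (x j)).indicator (fun _ => ENNReal.ofReal (a j)) s := by
    exact tsum_subtype {j | x j < s} (fun j => ENNReal.ofReal (a j))
  simp_rw [hsub, ← ENNReal.tsum_mul_left]
  rw [lintegral_tsum fun j => by
    refine (Measurable.mul (by fun_prop) ?_).aemeasurable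
    exact measurable_const.indicator measurableSet_Ioi]
  congr 1
  funext j
  have : ∀ s, ENNReal.ofReal (2 * t * Real.exp (-2 * s * t)) *
      (Set.Ioi (x j)).indicator (fun _ => ENNReal.ofReal (a j)) s =
      (Set.Ioi (x j)).indicator (fun s => ENNReal.ofReal (2 * t * Real.exp (-2 * s * t)) *
        ENNReal.ofReal (a j)) s := fun s =>
    (Set.indicator_mul_right (Set.Ioi (x j))
      (fun s => ENNReal.ofReal (2 * t * Real.exp (-2 * s * t))) _).symm
  simp_rw [this]
  rw [lintegral_indicator measurableSet_Ioi, Measure.restrict_restrict measurableSet_Ioi,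
    Set.inter_eq_left.mpr (Set.Ioi_subset_Ioi (hx j)), lintegral_mul_const _ (by fun_prop),
    lintegral_Ioi_mul_exp_neg ht, ENNReal.ofReal_mul (Real.exp_nonneg _)]

lemma tsum_lt_mono (x : ℕ → ℝ) (f : ℕ → ENNReal) {s s' : ℝ} (h : s ≤ s') :
    ∑' j : {j // x j < s}, f j.1 ≤ ∑' j : {j // x j < s'}, f j.1 :=
  ENNReal.tsum_mono_subtype f fun _ hj => lt_of_lt_of_le hj h

/-- The counting bounds at integers give a bound at every positive real. -/
lemma tsum_lt_le_of_int_bounds {C r : ℝ} (hC : 1 ≤ C) (hr : 200 ≤ r) {x a : ℕ → ℝ}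
    (h₂ : ∀ k : ℤ, 100 ≤ k → (k : ℝ) ≤ r / 10 →
      (∑' j : {j : ℕ // x j < (k : ℝ) + 1}, ENNReal.ofReal (a j.1)) ≤
        ENNReal.ofReal (C * r * ((k : ℝ) + 1) ^ ((1:ℝ)/2)))
    (h₃ : ∀ k : ℤ, r / 10 < (k : ℝ) →
      (∑' j : {j : ℕ // x j < (k : ℝ) + 1}, ENNReal.ofReal (a j.1)) ≤
        ENNReal.ofReal (C * ((k : ℝ) + 1) ^ ((3:ℝ)/2)))
    {s : ℝ} (hs : 0 < s) :
    ∑' j : {j // x j < s}, ENNReal.ofReal (a j.1) ≤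
      ENNReal.ofReal (11 * C * (r + r * s ^ ((1:ℝ)/2) +
        if r / 10 < s then s ^ ((3:ℝ)/2) else 0)) := by
  obtain ⟨k, hks, hsk⟩ : ∃ k : ℤ, (k : ℝ) < s ∧ s ≤ (k : ℝ) + 1 :=
    ⟨⌈s⌉ - 1, by push_cast; linarith [Int.ceil_lt_add_one s],
      by push_cast; linarith [Int.le_ceil s]⟩
  have hs1 : 0 ≤ s ^ ((1:ℝ)/2) := by positivity
  have hs3 : 0 ≤ s ^ ((3:ℝ)/2) := by positivity
  have hite : 0 ≤ if r / 10 < s then s ^ ((3:ℝ)/2) else 0 := by split_ifs <;> simp [hs3]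
  have hC0 : 0 < C := by linarith
  have hr0 : 0 < r := by linarith
  have hrs : 0 ≤ r * s ^ ((1:ℝ)/2) := by positivity
  have four1 : (4:ℝ) ^ ((1:ℝ)/2) = 2 := by
    rw [show (4:ℝ) = 2 ^ (2:ℝ) by norm_num, ← Real.rpow_mul (by norm_num)]; norm_num
  have four3 : (4:ℝ) ^ ((3:ℝ)/2) = 8 := by
    rw [show (4:ℝ) = 2 ^ (2:ℝ) by norm_num, ← Real.rpow_mul (by norm_num)]; norm_num
  by_cases hk : r / 10 < k
  · refine (tsum_lt_mono x (fun j => ENNReal.ofReal (a j)) hsk).trans ((h₃ k hk).trans (ENNReal.ofReal_le_ofReal ?_))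
    have h4 : ((k:ℝ) + 1) ^ ((3:ℝ)/2) ≤ 8 * s ^ ((3:ℝ)/2) := by
      rw [← four3, ← Real.mul_rpow (by norm_num) hs.le]
      exact Real.rpow_le_rpow (by linarith) (by linarith) (by norm_num)
    rw [if_pos (hk.trans hks), mul_comm 11 C, mul_assoc]
    gcongr
    linarith
  · by_cases hk' : 100 ≤ k
    · refine (tsum_lt_mono x (fun j => ENNReal.ofReal (a j)) hsk).trans
        ((h₂ k hk' (not_lt.mp hk)).trans (ENNReal.ofReal_le_ofReal ?_))
      have hk1 : (100:ℝ) ≤ k := by exact_mod_cast hk'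
      have h4 : ((k:ℝ) + 1) ^ ((1:ℝ)/2) ≤ 2 * s ^ ((1:ℝ)/2) := by
        refine le_of_le_of_eq (b := (4 * s) ^ ((1:ℝ)/2)) ?_
          (by rw [Real.mul_rpow (by norm_num) hs.le, four1])
        exact Real.rpow_le_rpow (by linarith) (by linarith) (by norm_num)
      have h5 := mul_le_mul_of_nonneg_left h4 hr0.le
      rw [mul_comm 11 C, mul_assoc, mul_assoc]
      refine mul_le_mul_of_nonneg_left ?_ hC0.le
      linarith
    · have hk1 : (k:ℝ) + 1 ≤ ((100:ℤ):ℝ) + 1 := by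
        have : k ≤ 100 := by omega
        exact_mod_cast Int.add_le_add_right this 1
      have h121 (p : ℝ) (hp : 0 ≤ p) : (((100:ℤ):ℝ) + 1) ^ p ≤ (11 ^ (2:ℝ)) ^ p :=
        Real.rpow_le_rpow (by norm_num) (by norm_num) hp
      by_cases hr' : r / 10 < ((100:ℤ):ℝ)
      · refine (tsum_lt_mono x (fun j => ENNReal.ofReal (a j)) (hsk.trans hk1)).trans
          ((h₃ 100 hr').trans (ENNReal.ofReal_le_ofReal ?_))
        have h6 := h121 (3/2) (by norm_num)
        rw [← Real.rpow_mul (by norm_num)] at h6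
        norm_num at h6
        rw [mul_comm 11 C, mul_assoc]
        gcongr
        norm_num
        linarith
      · refine (tsum_lt_mono x (fun j => ENNReal.ofReal (a j)) (hsk.trans hk1)).trans
          ((h₂ 100 le_rfl (not_lt.mp hr')).trans (ENNReal.ofReal_le_ofReal ?_))
        have h6 := h121 (1/2) (by norm_num)
        rw [← Real.rpow_mul (by norm_num)] at h6
        norm_num at h6
        have h5 := mul_le_mul_of_nonneg_left h6 hr0.le
        rw [mul_comm 11 C, mul_assoc, mul_assoc]
        refine mul_le_mul_of_nonneg_left ?_ hC0.le
        norm_num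
        linarith

/-- The abstract summation argument underlying Proposition 4.1 (the L²-in-space heat
kernel bound): sums of nonnegative terms are taken in `[0,∞]`. -/
theorem stmt4 : ∃ c : ℝ, 0 < c ∧ ∀ (C r : ℝ), 1 ≤ C → 200 ≤ r →
    ∀ (lam a : ℕ → ℝ), (∀ j, 0 ≤ a j) →
    (∑' j : {j : ℕ // |lam j| < 10}, ENNReal.ofReal (a j.1)) ≤ ENNReal.ofReal (C * r) →
    (∀ k : ℤ, 100 ≤ k → (k : ℝ) ≤ r / 10 →
      (∑' j : {j : ℕ // (lam j) ^ 2 < (k : ℝ) + 1}, ENNReal.ofReal (a j.1)) ≤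
        ENNReal.ofReal (C * r * ((k : ℝ) + 1) ^ ((1:ℝ)/2))) →
    (∀ k : ℤ, r / 10 < (k : ℝ) →
      (∑' j : {j : ℕ // (lam j) ^ 2 < (k : ℝ) + 1}, ENNReal.ofReal (a j.1)) ≤
        ENNReal.ofReal (C * ((k : ℝ) + 1) ^ ((3:ℝ)/2))) →
    ∀ t : ℝ, 0 < t →
    (∑' j : ℕ, ENNReal.ofReal (Real.exp (-2 * (lam j) ^ 2 * t) * a j)) ≤
      ENNReal.ofReal (c * C *
        (r + r * t ^ (-(1:ℝ)/2) + t ^ (-(3:ℝ)/2) * Real.exp (-(r * t) / 10))) := by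
  have hΓ₁ : 0 < Real.Gamma (3/2) := Real.Gamma_pos_of_pos (by norm_num)
  have hΓ₂ : 0 < Real.Gamma (5/2) := Real.Gamma_pos_of_pos (by norm_num)
  refine ⟨22 * (1 + Real.Gamma (3/2) + Real.Gamma (5/2)), by positivity, ?_⟩
  intro C r hC hr lam a _ _ h₂ h₃ t ht
  have hC0 : 0 < C := by linarith
  have hr0 : 0 < r := by linarith
  set E := Real.exp (-(r * t) / 10) with hE
  have hE0 : 0 < E := Real.exp_pos _
  let g (p s : ℝ) : ℝ := s ^ (p - 1) * Real.exp (-(t * s))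
  have hg (p : ℝ) {s : ℝ} (hs : 0 < s) : 0 ≤ g p s := by positivity
  have hgm (p : ℝ) : Measurable fun s => ENNReal.ofReal (g p s) := by
    simp only [g]; fun_prop
  rw [tsum_exp_mul_eq_lintegral ht (fun j => lam j ^ 2) a fun j => sq_nonneg _]
  calc _ ≤ ∫⁻ s in Set.Ioi (0:ℝ), (ENNReal.ofReal (22 * C * t * r) * ENNReal.ofReal (g 1 s) +
        ENNReal.ofReal (22 * C * t * r) * ENNReal.ofReal (g (3/2) s) +
        ENNReal.ofReal (22 * C * t * E) * ENNReal.ofReal (g (5/2) s)) := by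
        refine setLIntegral_mono' measurableSet_Ioi fun s hs => ?_
        replace hs : 0 < s := hs
        refine (mul_le_mul_right (tsum_lt_le_of_int_bounds hC hr h₂ h₃ hs) _).trans ?_
        have h1 := hg 1 hs
        have h3 := hg (3/2) hs
        have h5 := hg (5/2) hs
        rw [← ENNReal.ofReal_mul (by positivity), ← ENNReal.ofReal_mul (by positivity),
          ← ENNReal.ofReal_mul (by positivity), ← ENNReal.ofReal_mul (by positivity),
          ← ENNReal.ofReal_add (by positivity) (by positivity),
          ← ENNReal.ofReal_add (by positivity) (by positivity)]
        refine ENNReal.ofReal_le_ofReal ?_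
        have e1 : Real.exp (-2 * s * t) ≤ Real.exp (-(t * s)) :=
          Real.exp_le_exp.mpr (by nlinarith [mul_pos ht hs])
        have e2 : Real.exp (-2 * s * t) * (if r / 10 < s then s ^ ((3:ℝ)/2) else 0) ≤
            E * Real.exp (-(t * s)) * s ^ ((3:ℝ)/2) := by
          split_ifs with h
          · gcongr
            rw [hE, ← Real.exp_add]
            exact Real.exp_le_exp.mpr (by nlinarith [mul_lt_mul_of_pos_right h ht])
          · rw [mul_zero]; positivity
        have e3 : Real.exp (-2 * s * t) * (r + r * s ^ ((1:ℝ)/2)) ≤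
            Real.exp (-(t * s)) * (r + r * s ^ ((1:ℝ)/2)) := by gcongr
        have e4 := mul_le_mul_of_nonneg_left (add_le_add e3 e2)
          (show 0 ≤ 22 * C * t by positivity)
        simp only [g]
        rw [show (1:ℝ) - 1 = 0 by norm_num, show (3:ℝ)/2 - 1 = 1/2 by norm_num,
          show (5:ℝ)/2 - 1 = 3/2 by norm_num, Real.rpow_zero]
        linarith
    _ = ENNReal.ofReal (22 * C * (r + Real.Gamma (3/2) * (r * t ^ (-(1:ℝ)/2)) +
          Real.Gamma (5/2) * (t ^ (-(3:ℝ)/2) * E))) := by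
        rw [lintegral_add_right _ ((hgm _).const_mul _),
          lintegral_add_right _ ((hgm _).const_mul _),
          lintegral_const_mul _ (hgm _), lintegral_const_mul _ (hgm _),
          lintegral_const_mul _ (hgm _)]
        simp only [g]
        rw [lintegral_rpow_mul_exp_neg (by norm_num) ht, lintegral_rpow_mul_exp_neg (by norm_num) ht,
          lintegral_rpow_mul_exp_neg (by norm_num) ht, Real.Gamma_one,
          ← ENNReal.ofReal_mul (by positivity), ← ENNReal.ofReal_mul (by positivity),
          ← ENNReal.ofReal_mul (by positivity),
          ← ENNReal.ofReal_add (by positivity) (by positivity),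
          ← ENNReal.ofReal_add (by positivity) (by positivity)]
        have hpow (p : ℝ) : t * t ^ (-p) = t ^ (1 - p) := by
          rw [sub_eq_add_neg, Real.rpow_add ht, Real.rpow_one]
        have p1 := hpow 1
        have p3 := hpow (3/2)
        have p5 := hpow (5/2)
        rw [show (1:ℝ) - 1 = 0 by norm_num, Real.rpow_zero] at p1
        rw [show (1:ℝ) - 3/2 = -1/2 by norm_num] at p3
        rw [show (1:ℝ) - 5/2 = -3/2 by norm_num] at p5
        congr 1
        linear_combination 22 * C * r * p1 + 22 * C * r * Real.Gamma (3/2) * p3 +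
          22 * C * E * Real.Gamma (5/2) * p5
    _ ≤ _ := by
        refine ENNReal.ofReal_le_ofReal ?_
        have hA : 0 < r * t ^ (-(1:ℝ)/2) := by positivity
        have hB : 0 < t ^ (-(3:ℝ)/2) * E := by positivity
        generalize r * t ^ (-(1:ℝ)/2) = A at *
        generalize t ^ (-(3:ℝ)/2) * E = B at *
        rw [mul_right_comm 22 _ C, mul_assoc (22 * C)]
        gcongr
        nlinarith [mul_pos hΓ₁ hr0, mul_pos hΓ₁ hB, mul_pos hΓ₂ hr0, mul_pos hΓ₂ hA]
end

section
/- There is a universal constant c > 0 with the following property. Let C ≥ 1 and r ≥ 200 be real numbers, let t ∈ (0, 1], and let (λ_j)_{j∈ℕ} be a sequence of real numbers such that λ_j² ≥ r/9 for every j, and such that for every natural number k the set {j ∈ ℕ : λ_j² < k+1} has at most C·(k+1)^{3/2} elements. Then the sum of nonnegative terms ∑_{j∈ℕ} e^{−λ_j²·t} (taken in [0,∞]) satisfies ∑_{j∈ℕ} e^{−λ_j²·t} ≤ c·C·t^{−3/2}·e^{−r·t/20}. -/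
open MeasureTheory Real

/-- The polynomial weight `(m + 1)²` is summable against `e^{-m/2}`. -/
theorem summable_succ_sq_mul_exp_neg_half :
    Summable fun m : ℕ => ((m : ℝ) + 1) ^ 2 * Real.exp (-(m : ℝ) / 2) := by
  have h := (summable_nat_add_iff 1).2
    (Real.summable_pow_mul_exp_neg_nat_mul 2 (by norm_num : (0 : ℝ) < 1 / 2))
  refine (h.mul_left (Real.exp (1 / 2))).congr fun m => ?_
  rw [mul_left_comm, ← Real.exp_add]
  push_cast
  ring_nf

/-- If a finite family has at most `A (m + 1)²` members below `m + 1` for every `m`, then its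
exponential sum is bounded by `A` times a universal constant. -/
theorem sum_exp_neg_half_le_of_card_le {ι : Type*} (s : Finset ι) (x : ι → ℝ) (A : ℝ)
    (hA : 0 ≤ A) (hx : ∀ j ∈ s, 0 ≤ x j)
    (hcard : ∀ (m : ℕ) (u : Finset ι), (∀ j ∈ u, x j < (m : ℝ) + 1) →
      (u.card : ℝ) ≤ A * ((m : ℝ) + 1) ^ 2) :
    ∑ j ∈ s, Real.exp (-(x j) / 2) ≤
      A * ∑' m : ℕ, ((m : ℝ) + 1) ^ 2 * Real.exp (-(m : ℝ) / 2) := by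
  classical
  rw [← Finset.sum_fiberwise_of_maps_to (t := s.image fun j => ⌊x j⌋₊)
    (fun j hj => Finset.mem_image_of_mem (fun j => ⌊x j⌋₊) hj), ← tsum_mul_left]
  refine le_trans (Finset.sum_le_sum fun m _ => ?_)
    ((summable_succ_sq_mul_exp_neg_half.mul_left A).sum_le_tsum
      (s.image fun j => ⌊x j⌋₊) fun m _ => by positivity)
  calc ∑ j ∈ s with ⌊x j⌋₊ = m, Real.exp (-(x j) / 2)
      ≤ ∑ j ∈ s with ⌊x j⌋₊ = m, Real.exp (-(m : ℝ) / 2) := by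
        refine Finset.sum_le_sum fun j hj => Real.exp_le_exp.2 ?_
        obtain ⟨hjs, rfl⟩ := Finset.mem_filter.1 hj
        have := Nat.floor_le (hx j hjs)
        linarith
    _ ≤ A * (((m : ℝ) + 1) ^ 2 * Real.exp (-(m : ℝ) / 2)) := by
        rw [Finset.sum_const, nsmul_eq_mul, ← mul_assoc]
        gcongr
        refine hcard m _ fun j hj => ?_
        obtain ⟨-, rfl⟩ := Finset.mem_filter.1 hj
        exact Nat.lt_floor_add_one _

/-- Rescaling by `t ≤ 1` a counting bound of order `3/2`. -/
theorem card_le_of_mul_lt {ι : Type*} {C t : ℝ} (hC : 0 ≤ C) (ht : 0 < t) (ht1 : t ≤ 1)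
    {y : ι → ℝ}
    (hcard : ∀ (k : ℕ) (s : Finset ι), (∀ j ∈ s, y j < (k : ℝ) + 1) →
      (s.card : ℝ) ≤ C * ((k : ℝ) + 1) ^ ((3 : ℝ) / 2))
    (m : ℕ) (u : Finset ι) (hu : ∀ j ∈ u, y j * t < (m : ℝ) + 1) :
    (u.card : ℝ) ≤ 9 * C * t ^ (-(3 : ℝ) / 2) * ((m : ℝ) + 1) ^ 2 := by
  have hm : (1 : ℝ) ≤ (m : ℝ) + 1 := by simp
  have hk : ((⌈((m : ℝ) + 1) / t⌉₊ : ℝ) + 1) ≤ 3 * ((m : ℝ) + 1) * t⁻¹ := by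
    have h1 : (1 : ℝ) ≤ ((m : ℝ) + 1) / t := by
      rw [le_div_iff₀ ht]
      linarith
    have h2 := Nat.ceil_lt_add_one (by positivity : 0 ≤ ((m : ℝ) + 1) / t)
    rw [mul_assoc, ← div_eq_mul_inv]
    linarith
  have hpow : (3 * ((m : ℝ) + 1)) ^ ((3 : ℝ) / 2) ≤ 9 * ((m : ℝ) + 1) ^ 2 := by
    calc (3 * ((m : ℝ) + 1)) ^ ((3 : ℝ) / 2) ≤ (3 * ((m : ℝ) + 1)) ^ (2 : ℝ) :=
          Real.rpow_le_rpow_of_exponent_le (by linarith) (by norm_num)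
      _ = 9 * ((m : ℝ) + 1) ^ 2 := by
          rw [Real.rpow_two]
          ring
  calc (u.card : ℝ) ≤ C * ((⌈((m : ℝ) + 1) / t⌉₊ : ℝ) + 1) ^ ((3 : ℝ) / 2) := by
        refine hcard _ u fun j hj => ?_
        have h1 := (lt_div_iff₀ ht).2 (hu j hj)
        have h2 := Nat.le_ceil (((m : ℝ) + 1) / t)
        linarith
    _ ≤ C * (3 * ((m : ℝ) + 1) * t⁻¹) ^ ((3 : ℝ) / 2) := by gcongr
    _ = C * ((3 * ((m : ℝ) + 1)) ^ ((3 : ℝ) / 2) * t ^ (-(3 : ℝ) / 2)) := by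
        rw [Real.mul_rpow (by positivity) (by positivity), Real.inv_rpow ht.le,
          ← Real.rpow_neg ht.le, neg_div]
    _ ≤ C * (9 * ((m : ℝ) + 1) ^ 2 * t ^ (-(3 : ℝ) / 2)) := by gcongr
    _ = 9 * C * t ^ (-(3 : ℝ) / 2) * ((m : ℝ) + 1) ^ 2 := by ring

/-- The abstract form of estimate (5.6) in the proof of Proposition 5.2: a bound for
`∑ e^{-λ_j²t}` over eigenvalues with `λ_j² ≥ r/9`, given the counting bound
that `{j : λ_j² < k+1}` has at most `C(k+1)^{3/2}` elements. -/
theorem stmt5 : ∃ c : ℝ, 0 < c ∧ ∀ (C r : ℝ), 1 ≤ C → 200 ≤ r →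
    ∀ t : ℝ, 0 < t → t ≤ 1 →
    ∀ lam : ℕ → ℝ, (∀ j, r / 9 ≤ (lam j) ^ 2) →
    (∀ (k : ℕ) (s : Finset ℕ), (∀ j ∈ s, (lam j) ^ 2 < (k : ℝ) + 1) →
      (s.card : ℝ) ≤ C * ((k : ℝ) + 1) ^ ((3:ℝ)/2)) →
    (∑' j : ℕ, ENNReal.ofReal (Real.exp (-(lam j) ^ 2 * t))) ≤
      ENNReal.ofReal (c * C * t ^ (-(3:ℝ)/2) * Real.exp (-(r * t) / 20)) := by
  refine ⟨9 * ∑' m : ℕ, ((m : ℝ) + 1) ^ 2 * Real.exp (-(m : ℝ) / 2), mul_pos (by norm_num)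
    (summable_succ_sq_mul_exp_neg_half.tsum_pos (fun m => by positivity) 0 (by positivity)), ?_⟩
  intro C r hC hr t ht ht1 lam hlam hcard
  have hC0 : 0 ≤ C := by linarith
  rw [ENNReal.tsum_eq_iSup_sum]
  refine iSup_le fun s => ?_
  rw [← ENNReal.ofReal_sum_of_nonneg fun j _ => (Real.exp_pos _).le]
  refine ENNReal.ofReal_le_ofReal ?_
  calc ∑ j ∈ s, Real.exp (-(lam j) ^ 2 * t)
      ≤ ∑ j ∈ s, Real.exp (-((lam j) ^ 2 * t) / 2) * Real.exp (-(r * t) / 20) := by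
        refine Finset.sum_le_sum fun j _ => ?_
        rw [← Real.exp_add, Real.exp_le_exp]
        have h1 := mul_le_mul_of_nonneg_right (hlam j) ht.le
        have h2 : 0 ≤ r * t := by positivity
        linarith
    _ ≤ _ := by
        rw [← Finset.sum_mul]
        gcongr
        refine (sum_exp_neg_half_le_of_card_le s (fun j => (lam j) ^ 2 * t)
          (9 * C * t ^ (-(3 : ℝ) / 2)) (by positivity) (fun j _ => by positivity)
          (card_le_of_mul_lt hC0 ht ht1 hcard)).trans_eq ?_
        ring
end

section
/- There is a universal constant c > 0 such that for all r > 0, t > 0, Ω ∈ [9/10, 10/9], and all p ∈ ℝ³, one has e^{Ω⁻²·r·t}·κ_{r,Ω}(t; 0, p) ≤ c·(1 + r·t)·t^{−3/2}·exp(−|p|²/(8t)). -/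
open MeasureTheory Real

/-- The (absolute value of the) Mehler-type heat kernel for the model operator in §4.2:
`κ_{r,Ω}(t;p₁,p₂) = (4π)^{-3/2} Ω t^{-1/2} exp(-Ω²(z₁-z₂)²/(4t)) ·
  (r/sinh(Ω⁻²rt)) · exp(-(r/4) coth(Ω⁻²rt)((x₁-x₂)²+(y₁-y₂)²))`. -/
noncomputable def kappa (r t Ω : ℝ) (p₁ p₂ : EuclideanSpace ℝ (Fin 3)) : ℝ :=
  (4 * Real.pi) ^ (-(3:ℝ)/2) * Ω * t ^ (-(1:ℝ)/2) *
    Real.exp (-(Ω ^ 2 * (p₁ 2 - p₂ 2) ^ 2) / (4 * t)) *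
    (r / Real.sinh ((Ω ^ 2)⁻¹ * r * t)) *
    Real.exp (-(r / 4) * (Real.cosh ((Ω ^ 2)⁻¹ * r * t) / Real.sinh ((Ω ^ 2)⁻¹ * r * t)) *
      ((p₁ 0 - p₂ 0) ^ 2 + (p₁ 1 - p₂ 1) ^ 2))

theorem Real.sinh_le_self_mul_cosh {s : ℝ} (hs : 0 ≤ s) : sinh s ≤ s * cosh s := by
  have hmono : MonotoneOn (fun x : ℝ => x * cosh x - sinh x) (Set.Ici 0) := by
    have hd (x : ℝ) : HasDerivAt (fun x : ℝ => x * cosh x - sinh x) (x * sinh x) x := by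
      have h := ((hasDerivAt_id' x).mul (hasDerivAt_cosh x)).sub (hasDerivAt_sinh x)
      exact h.congr_deriv (by ring)
    refine monotoneOn_of_deriv_nonneg (convex_Ici 0)
      (fun x _ => (hd x).continuousAt.continuousWithinAt)
      (fun x _ => (hd x).differentiableAt.differentiableWithinAt) fun x hx => ?_
    rw [interior_Ici] at hx
    rw [(hd x).deriv]
    exact mul_nonneg hx.le (sinh_nonneg_iff.2 hx.le)
  have h := hmono Set.self_mem_Ici (Set.mem_Ici.2 hs) hs
  simp only [zero_mul, sinh_zero, sub_zero] at h
  linarith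

theorem Real.self_mul_exp_le_mul_sinh (s : ℝ) : s * exp s ≤ (1 + 2 * s) * sinh s := by
  have h : (2 * s + 1) * exp (-s) ≤ exp (2 * s) * exp (-s) := by
    gcongr
    exact add_one_le_exp _
  rw [← exp_add, show 2 * s + -s = s by ring] at h
  rw [sinh_eq]
  linarith

/-- The off-diagonal Gaussian upper bound for the model heat kernel:
`e^{Ω⁻²rt} κ_{r,Ω}(t;0,p) ≤ c(1+rt)t^{-3/2} exp(-|p|²/(8t))`. -/
theorem stmt7 : ∃ c : ℝ, 0 < c ∧ ∀ (r t Ω : ℝ), 0 < r → 0 < t →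
    Ω ∈ Set.Icc (9/10 : ℝ) (10/9) → ∀ p : EuclideanSpace ℝ (Fin 3),
    Real.exp ((Ω ^ 2)⁻¹ * r * t) * kappa r t Ω 0 p ≤
      c * (1 + r * t) * t ^ (-(3:ℝ)/2) * Real.exp (-‖p‖ ^ 2 / (8 * t)) := by
  refine ⟨4, by norm_num, fun r t Ω hr ht ⟨hΩ₁, hΩ₂⟩ p => ?_⟩
  have hΩ : 0 < Ω := by linarith
  have hΩsq : 81 / 100 ≤ Ω ^ 2 := by nlinarith
  have hΩsq' : Ω ^ 2 ≤ 100 / 81 := by nlinarith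
  obtain ⟨s, hs⟩ : ∃ s, s = (Ω ^ 2)⁻¹ * r * t := ⟨_, rfl⟩
  have hs₀ : 0 < s := by rw [hs]; positivity
  have hrs : r = Ω ^ 2 * s / t := by rw [hs]; field_simp
  have hsinh : 0 < sinh s := sinh_pos_iff.2 hs₀
  have hpow : t ^ (-(3:ℝ)/2) = t ^ (-(1:ℝ)/2) * t⁻¹ := by
    rw [← rpow_neg_one t, ← rpow_add ht]
    norm_num
  have hconst : (4 * π) ^ (-(3:ℝ)/2) ≤ 1 :=
    rpow_le_one_of_one_le_of_nonpos (by linarith [pi_gt_three]) (by norm_num)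
  have hamp : exp s * (r / sinh s) ≤ 2 * (1 + r * t) * t⁻¹ := by
    have h : s * exp s / sinh s ≤ 1 + 2 * s :=
      (div_le_iff₀ hsinh).2 (self_mul_exp_le_mul_sinh s)
    have hrt : r * t = Ω ^ 2 * s := by rw [hrs]; field_simp
    calc exp s * (r / sinh s) = Ω ^ 2 * (s * exp s / sinh s) * t⁻¹ := by rw [hrs]; ring
      _ ≤ Ω ^ 2 * (1 + 2 * s) * t⁻¹ := by gcongr
      _ ≤ 2 * (1 + r * t) * t⁻¹ := by
        refine mul_le_mul_of_nonneg_right ?_ (by positivity)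
        rw [hrt]
        linarith
  have hcoth : 1 / (8 * t) ≤ r / 4 * (cosh s / sinh s) := by
    have h : 1 ≤ s * cosh s / sinh s :=
      (one_le_div hsinh).2 (sinh_le_self_mul_cosh hs₀.le)
    calc 1 / (8 * t) = 1 / 8 * 1 * t⁻¹ := by field_simp
      _ ≤ Ω ^ 2 / 4 * (s * cosh s / sinh s) * t⁻¹ := by
        have hΩ₈ : 1 / 8 ≤ Ω ^ 2 / 4 := by linarith
        gcongr
      _ = r / 4 * (cosh s / sinh s) := by rw [hrs]; ring
  have hnorm : ‖p‖ ^ 2 = p 0 ^ 2 + p 1 ^ 2 + p 2 ^ 2 := by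
    simp [EuclideanSpace.real_norm_sq_eq, Fin.sum_univ_three]
  have hexp : exp (-(Ω ^ 2 * p 2 ^ 2) / (4 * t)) *
      exp (-(r / 4) * (cosh s / sinh s) * (p 0 ^ 2 + p 1 ^ 2)) ≤ exp (-‖p‖ ^ 2 / (8 * t)) := by
    rw [← exp_add, exp_le_exp, hnorm]
    have hxy := mul_le_mul_of_nonneg_right hcoth (by positivity : 0 ≤ p 0 ^ 2 + p 1 ^ 2)
    have hz : 1 / (8 * t) * p 2 ^ 2 ≤ Ω ^ 2 * p 2 ^ 2 / (4 * t) := by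
      calc 1 / (8 * t) * p 2 ^ 2 = 1 / 2 * p 2 ^ 2 / (4 * t) := by ring
        _ ≤ Ω ^ 2 * p 2 ^ 2 / (4 * t) := by
          gcongr
          linarith
    have hsplit : -(p 0 ^ 2 + p 1 ^ 2 + p 2 ^ 2) / (8 * t) =
        -(1 / (8 * t) * (p 0 ^ 2 + p 1 ^ 2)) - 1 / (8 * t) * p 2 ^ 2 := by ring
    rw [hsplit, neg_div]
    linarith
  simp only [kappa, PiLp.zero_apply, zero_sub, neg_sq]
  rw [← hs, hpow]
  calc _ = ((4 * π) ^ (-(3:ℝ)/2) * Ω) * t ^ (-(1:ℝ)/2) * (exp s * (r / sinh s)) *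
        (exp (-(Ω ^ 2 * p 2 ^ 2) / (4 * t)) *
          exp (-(r / 4) * (cosh s / sinh s) * (p 0 ^ 2 + p 1 ^ 2))) := by ring
    _ ≤ (1 * 2) * t ^ (-(1:ℝ)/2) * (2 * (1 + r * t) * t⁻¹) * exp (-‖p‖ ^ 2 / (8 * t)) := by
        gcongr
        linarith
    _ = _ := by ring
end

section
/- There is a universal constant c > 0 such that for all r > 0, t > 0, and Ω ∈ [9/10, 10/9], one has ∫_{ℝ³} ( e^{Ω⁻²·r·t}·κ_{r,Ω}(t; 0, p) )² dp ≤ c·( r·t^{−1/2} + t^{−3/2} ). -/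
open MeasureTheory Real

lemma EuclideanSpace.integral_exp_neg_sum_mul_sq {ι : Type*} [Fintype ι] (b : ι → ℝ) :
    ∫ p : EuclideanSpace ℝ ι, exp (∑ i, -b i * p i ^ 2) = ∏ i, √(π / b i) := by
  rw [← (PiLp.volume_preserving_toLp ι).integral_comp
    (MeasurableEquiv.toLp 2 (ι → ℝ)).measurableEmbedding]
  simp_rw [exp_sum]
  rw [integral_fintype_prod_volume_eq_prod (f := fun i (x : ℝ) ↦ exp (-b i * x ^ 2))]
  simp_rw [integral_gaussian]

lemma exp_two_mul_div_sinh_mul_cosh_le {s : ℝ} (hs : 0 < s) :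
    exp (2 * s) / (sinh s * cosh s) ≤ 4 + 1 / s := by
  have hsc : 0 < sinh s * cosh s := mul_pos (sinh_pos_iff.2 hs) (cosh_pos s)
  have key : sinh s * cosh s = (exp (2 * s) - (exp (2 * s))⁻¹) / 4 := by
    rw [sinh_eq, cosh_eq, ← exp_neg, two_mul, neg_add, exp_add, exp_add]
    ring
  have hE : 4 * s + 1 ≤ exp (2 * s) * exp (2 * s) := by
    rw [← exp_add]
    convert add_one_le_exp (4 * s) using 2
    ring
  have hE' : (4 * s + 1) * (exp (2 * s))⁻¹ ≤ exp (2 * s) := by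
    rwa [← div_eq_mul_inv, div_le_iff₀ (exp_pos _)]
  rw [div_le_iff₀ hsc, key, show 4 + 1 / s = (4 * s + 1) / s by field_simp, div_mul_eq_mul_div,
    le_div_iff₀ hs]
  linarith

lemma integral_sq_exp_mul_kappa {r t Ω : ℝ} (hr : 0 < r) (ht : 0 < t) (hΩ : 0 < Ω) :
    ∫ p : EuclideanSpace ℝ (Fin 3), (exp ((Ω ^ 2)⁻¹ * r * t) * kappa r t Ω 0 p) ^ 2 =
      ((4 * π) ^ (-(3 : ℝ) / 2)) ^ 2 * √(2 * π) * (2 * π) * (Ω * t ^ (-(1 : ℝ) / 2) * r *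
        (exp (2 * ((Ω ^ 2)⁻¹ * r * t)) /
          (sinh ((Ω ^ 2)⁻¹ * r * t) * cosh ((Ω ^ 2)⁻¹ * r * t)))) := by
  set s := (Ω ^ 2)⁻¹ * r * t
  have hsh : 0 < sinh s := sinh_pos_iff.2 (by positivity)
  have hch : 0 < cosh s := cosh_pos s
  set b : ℝ := r / 2 * (cosh s / sinh s)
  have hb : 0 < b := by positivity
  have hpow : t ^ (-(1 : ℝ) / 2) = (√t)⁻¹ := by
    rw [neg_div, rpow_neg ht.le, sqrt_eq_rpow]
  have hfun (p : EuclideanSpace ℝ (Fin 3)) : (exp s * kappa r t Ω 0 p) ^ 2 =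
      ((4 * π) ^ (-(3 : ℝ) / 2) * Ω * t ^ (-(1 : ℝ) / 2) * (r / sinh s) * exp s) ^ 2 *
        exp (∑ i, -(![b, b, Ω ^ 2 / (2 * t)] i) * p i ^ 2) := by
    have hexp : exp (∑ i, -(![b, b, Ω ^ 2 / (2 * t)] i) * p i ^ 2) =
        (exp (-(Ω ^ 2 * (0 - p 2) ^ 2) / (4 * t)) *
          exp (-(r / 4) * (cosh s / sinh s) * ((0 - p 0) ^ 2 + (0 - p 1) ^ 2))) ^ 2 := by
      rw [← exp_add, ← exp_nat_mul]
      congr 1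
      simp only [Fin.sum_univ_three, Matrix.cons_val, b]
      push_cast
      field_simp
      ring
    rw [hexp, kappa]
    simp only [PiLp.zero_apply]
    ring
  have hgauss : √(π / (Ω ^ 2 / (2 * t))) = √(2 * π) * √t / Ω := by
    rw [← sqrt_mul (by positivity), ← sqrt_sq hΩ.le, ← sqrt_div (by positivity), sqrt_sq hΩ.le]
    congr 1
    field_simp
  simp_rw [hfun]
  rw [integral_const_mul, EuclideanSpace.integral_exp_neg_sum_mul_sq]
  simp only [Fin.prod_univ_three, Matrix.cons_val]
  rw [mul_self_sqrt (by positivity), hgauss, hpow, two_mul s, exp_add]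
  simp only [b]
  field_simp

/-- Estimate (4.17) in the proof of Theorem 4.2: the L² bound
`∫_{ℝ³} (e^{Ω⁻²rt} κ_{r,Ω}(t;0,p))² dp ≤ c(rt^{-1/2} + t^{-3/2})`. -/
theorem stmt8 : ∃ c : ℝ, 0 < c ∧ ∀ (r t Ω : ℝ), 0 < r → 0 < t →
    Ω ∈ Set.Icc (9/10 : ℝ) (10/9) →
    (∫ p : EuclideanSpace ℝ (Fin 3),
        (Real.exp ((Ω ^ 2)⁻¹ * r * t) * kappa r t Ω 0 p) ^ 2) ≤
      c * (r * t ^ (-(1:ℝ)/2) + t ^ (-(3:ℝ)/2)) := by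
  set K : ℝ := ((4 * π) ^ (-(3 : ℝ) / 2)) ^ 2 * √(2 * π) * (2 * π)
  have hK : 0 < K := by positivity
  refine ⟨K * 8, by positivity, fun r t Ω hr ht ⟨hΩ₁, hΩ₂⟩ ↦ ?_⟩
  have hΩ : 0 < Ω := by linarith
  have hpow : t ^ (-(3 : ℝ) / 2) = t ^ (-(1 : ℝ) / 2) * t⁻¹ := by
    rw [← rpow_neg_one t, ← rpow_add ht]
    norm_num
  rw [integral_sq_exp_mul_kappa hr ht hΩ, mul_assoc K 8, hpow]
  refine mul_le_mul_of_nonneg_left ?_ hK.le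
  have hu : 0 < t ^ (-(1 : ℝ) / 2) := by positivity
  set u := t ^ (-(1 : ℝ) / 2)
  have hΩ_cube : Ω ^ 3 ≤ 8 := by
    calc Ω ^ 3 ≤ 2 ^ 3 := by gcongr; linarith
      _ = 8 := by norm_num
  calc Ω * u * r * _ ≤ Ω * u * r * (4 + 1 / ((Ω ^ 2)⁻¹ * r * t)) := by
        gcongr
        exact exp_two_mul_div_sinh_mul_cosh_le (by positivity)
    _ = 4 * Ω * (r * u) + Ω ^ 3 * (u * t⁻¹) := by field_simp
    _ ≤ 8 * (r * u) + 8 * (u * t⁻¹) := by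
        gcongr
        linarith
    _ = 8 * (r * u + u * t⁻¹) := by ring
end

section
/- For every ℓ > 0 there is a constant c > 0 such that for all r > 0, all t with 0 < t ≤ 1, and all Ω ∈ [9/10, 10/9], one has ∫_{{p ∈ ℝ³ : |p| ≥ ℓ}} ( e^{Ω⁻²·r·t}·κ_{r,Ω}(t; 0, p) )² dp ≤ c·(1 + r²·t²)·e^{−1/(c·t)}. -/
open MeasureTheory Real

/-- The Gaussian `exp (-b ‖v‖ ^ 2)` is integrable on a Euclidean space. -/
theorem integrable_exp_neg_mul_sq_norm {ι : Type*} [Fintype ι] {b : ℝ} (hb : 0 < b) :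
    Integrable fun v : EuclideanSpace ℝ ι => Real.exp (-b * ‖v‖ ^ 2) := by
  have h := (GaussianFourier.integrable_cexp_neg_mul_sq_norm_add (V := EuclideanSpace ℝ ι)
    (b := (b : ℂ)) (by simpa using hb) 0 0).norm
  refine h.congr (Filter.Eventually.of_forall fun v => ?_)
  simp only [Complex.norm_exp]
  congr 1
  simp [← Complex.ofReal_pow, ← Complex.ofReal_neg, ← Complex.ofReal_mul]

theorem exp_div_sinh_le {s : ℝ} (hs : 0 < s) : Real.exp s / Real.sinh s ≤ 2 + 1 / s := by
  have hsinh : s ≤ Real.sinh s := Real.self_le_sinh_iff.2 hs.le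
  have hexp : Real.exp s = 2 * Real.sinh s + Real.exp (-s) := by
    rw [Real.sinh_eq]; ring
  have h1 : Real.exp (-s) ≤ 1 := Real.exp_le_one_iff.2 (by linarith)
  have h2 : 1 ≤ 1 / s * Real.sinh s := by
    rw [one_div_mul_eq_div, one_le_div hs]; exact hsinh
  rw [div_le_iff₀ (hs.trans_le hsinh)]
  linarith

theorem inv_two_mul_le_cosh_div_sinh {s : ℝ} (hs : 0 < s) :
    (2 * s)⁻¹ ≤ Real.cosh s / Real.sinh s := by
  have hsinh : 0 < Real.sinh s := Real.sinh_pos_iff.2 hs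
  rw [le_div_iff₀ hsinh, inv_mul_le_iff₀ (by positivity), Real.sinh_eq, Real.cosh_eq]
  have h1 : Real.exp (-s) = Real.exp s * Real.exp (-(2 * s)) := by
    rw [← Real.exp_add]; ring_nf
  have h2 : 1 - 2 * s ≤ Real.exp (-(2 * s)) := by
    linarith [Real.add_one_le_exp (-(2 * s))]
  have h3 := mul_le_mul_of_nonneg_left h2 (Real.exp_pos s).le
  have h4 : 0 ≤ s * Real.exp (-s) := by positivity
  linarith

/-- The amplitude of `exp (Ω⁻² r t) * kappa r t Ω` is of order `(1 + r t) t ^ (-3/2)`. -/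
theorem sq_amplitude_le {r t Ω : ℝ} (hr : 0 < r) (ht : 0 < t)
    (hΩ : Ω ∈ Set.Icc (9 / 10 : ℝ) (10 / 9)) :
    ((4 * Real.pi) ^ (-(3 : ℝ) / 2) * Ω * t ^ (-(1 : ℝ) / 2) *
      (r * (Real.exp ((Ω ^ 2)⁻¹ * r * t) / Real.sinh ((Ω ^ 2)⁻¹ * r * t)))) ^ 2 ≤
      16 * (1 + r ^ 2 * t ^ 2) * (t⁻¹) ^ 3 := by
  obtain ⟨hΩ₁, hΩ₂⟩ := hΩ
  have hΩ₀ : 0 < Ω := by linarith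
  have hΩ_sq : Ω ^ 2 ≤ 100 / 81 := by nlinarith
  have hpi : (4 * Real.pi) ^ (-(3 : ℝ) / 2) ≤ 1 :=
    Real.rpow_le_one_of_one_le_of_nonpos (by linarith [Real.pi_gt_three]) (by norm_num)
  have hs : 0 < (Ω ^ 2)⁻¹ * r * t := by positivity
  have hquot : r * (Real.exp ((Ω ^ 2)⁻¹ * r * t) / Real.sinh ((Ω ^ 2)⁻¹ * r * t)) ≤
      t⁻¹ * (2 * (r * t) + Ω ^ 2) := by
    refine (mul_le_mul_of_nonneg_left (exp_div_sinh_le hs) hr.le).trans_eq ?_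
    field_simp
  have hquot₀ : 0 ≤ r * (Real.exp ((Ω ^ 2)⁻¹ * r * t) / Real.sinh ((Ω ^ 2)⁻¹ * r * t)) :=
    mul_nonneg hr.le (div_nonneg (Real.exp_pos _).le (Real.sinh_nonneg_iff.2 hs.le))
  have ht_sq : (t ^ (-(1 : ℝ) / 2)) ^ 2 = t⁻¹ := by
    rw [← Real.rpow_natCast, ← Real.rpow_mul ht.le]
    norm_num [Real.rpow_neg_one]
  have hpoly : Ω ^ 2 * (2 * (r * t) + Ω ^ 2) ^ 2 ≤ 16 * (1 + r ^ 2 * t ^ 2) := by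
    have hrt : 0 < r * t := by positivity
    have h : (2 * (r * t) + Ω ^ 2) ^ 2 ≤ (2 * (r * t) + 100 / 81) ^ 2 := by gcongr
    calc Ω ^ 2 * (2 * (r * t) + Ω ^ 2) ^ 2
        ≤ 100 / 81 * (2 * (r * t) + 100 / 81) ^ 2 := by gcongr
      _ ≤ 16 * (1 + r ^ 2 * t ^ 2) := by nlinarith [sq_nonneg (r * t - 1)]
  calc _ ≤ (1 * Ω * t ^ (-(1 : ℝ) / 2) * (t⁻¹ * (2 * (r * t) + Ω ^ 2))) ^ 2 := by gcongr
    _ = (t ^ (-(1 : ℝ) / 2)) ^ 2 * (t⁻¹) ^ 2 * (Ω ^ 2 * (2 * (r * t) + Ω ^ 2) ^ 2) := by ring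
    _ ≤ (t ^ (-(1 : ℝ) / 2)) ^ 2 * (t⁻¹) ^ 2 * (16 * (1 + r ^ 2 * t ^ 2)) := by gcongr
    _ = 16 * (1 + r ^ 2 * t ^ 2) * (t⁻¹) ^ 3 := by rw [ht_sq]; ring

/-- Gaussian upper bound for the squared, rescaled model kernel. -/
theorem sq_exp_mul_kappa_le {r t Ω : ℝ} (hr : 0 < r) (ht : 0 < t)
    (hΩ : Ω ∈ Set.Icc (9 / 10 : ℝ) (10 / 9)) (p : EuclideanSpace ℝ (Fin 3)) :
    (Real.exp ((Ω ^ 2)⁻¹ * r * t) * kappa r t Ω 0 p) ^ 2 ≤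
      16 * (1 + r ^ 2 * t ^ 2) * (t⁻¹) ^ 3 * Real.exp (-(‖p‖ ^ 2 / (5 * t))) := by
  have hamp := sq_amplitude_le hr ht hΩ
  obtain ⟨hΩ₁, hΩ₂⟩ := hΩ
  have hΩ₀ : 0 < Ω := by linarith
  have hΩ_sq : 81 / 100 ≤ Ω ^ 2 := by nlinarith
  have hs : 0 < (Ω ^ 2)⁻¹ * r * t := by positivity
  have hcoth := inv_two_mul_le_cosh_div_sinh hs
  set s := (Ω ^ 2)⁻¹ * r * t with hs_def
  have hrcoth : 81 / 200 / t ≤ r * (Real.cosh s / Real.sinh s) := by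
    refine le_trans ?_ (mul_le_mul_of_nonneg_left hcoth hr.le)
    have : r * (2 * s)⁻¹ = Ω ^ 2 / 2 / t := by rw [hs_def]; field_simp
    rw [this]
    exact div_le_div_of_nonneg_right (by linarith) ht.le
  have hsplit : (Real.exp s * kappa r t Ω 0 p) ^ 2 =
      ((4 * Real.pi) ^ (-(3 : ℝ) / 2) * Ω * t ^ (-(1 : ℝ) / 2) *
        (r * (Real.exp s / Real.sinh s))) ^ 2 *
      Real.exp (-(Ω ^ 2 / 2 / t * p 2 ^ 2 +
        r * (Real.cosh s / Real.sinh s) / 2 * (p 0 ^ 2 + p 1 ^ 2))) := by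
    have hexp : Real.exp (-(Ω ^ 2 / 2 / t * p 2 ^ 2 +
        r * (Real.cosh s / Real.sinh s) / 2 * (p 0 ^ 2 + p 1 ^ 2))) =
        (Real.exp (-(Ω ^ 2 * (0 - p 2) ^ 2) / (4 * t)) *
          Real.exp (-(r / 4) * (Real.cosh s / Real.sinh s) *
            ((0 - p 0) ^ 2 + (0 - p 1) ^ 2))) ^ 2 := by
      rw [← Real.exp_add, ← Real.exp_nat_mul]
      congr 1
      push_cast
      field_simp
      ring
    rw [hexp]
    simp only [kappa, ← hs_def, PiLp.zero_apply]
    ring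
  rw [hsplit]
  refine mul_le_mul hamp (Real.exp_le_exp.2 (neg_le_neg ?_)) (Real.exp_pos _).le (by positivity)
  rw [EuclideanSpace.real_norm_sq_eq, Fin.sum_univ_three]
  have hz : 1 / 5 / t ≤ Ω ^ 2 / 2 / t :=
    div_le_div_of_nonneg_right (by linarith) ht.le
  have hxy : 1 / 5 / t ≤ r * (Real.cosh s / Real.sinh s) / 2 := by
    have : 1 / 5 / t ≤ 81 / 200 / t / 2 := by
      rw [div_right_comm _ t 2]; exact div_le_div_of_nonneg_right (by norm_num) ht.le
    linarith
  calc (p 0 ^ 2 + p 1 ^ 2 + p 2 ^ 2) / (5 * t)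
      = 1 / 5 / t * p 2 ^ 2 + 1 / 5 / t * (p 0 ^ 2 + p 1 ^ 2) := by field_simp; ring
    _ ≤ _ := by gcongr

/-- An exponential `exp (-2 a / t)` absorbs the factor `t ^ (-3)`. -/
theorem inv_pow_three_mul_exp_le {a t : ℝ} (ha : 0 < a) (ht : 0 < t) :
    (t⁻¹) ^ 3 * Real.exp (-(2 * a / t)) ≤ 6 * (a⁻¹) ^ 3 * Real.exp (-(a / t)) := by
  have h := Real.pow_div_factorial_le_exp (x := a / t) (by positivity) 3
  have hsplit : Real.exp (-(2 * a / t)) = Real.exp (-(a / t)) * Real.exp (-(a / t)) := by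
    rw [← Real.exp_add]; ring_nf
  calc (t⁻¹) ^ 3 * Real.exp (-(2 * a / t))
      = 6 * (a⁻¹) ^ 3 * ((a / t) ^ 3 / (Nat.factorial 3 : ℕ)) *
          (Real.exp (-(a / t)) * Real.exp (-(a / t))) := by
        rw [hsplit]; norm_num [Nat.factorial]; field_simp
    _ ≤ 6 * (a⁻¹) ^ 3 * Real.exp (a / t) * (Real.exp (-(a / t)) * Real.exp (-(a / t))) := by
        gcongr
    _ = 6 * (a⁻¹) ^ 3 * Real.exp (-(a / t)) * (Real.exp (a / t) * Real.exp (-(a / t))) := by ring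
    _ = 6 * (a⁻¹) ^ 3 * Real.exp (-(a / t)) := by rw [← Real.exp_add]; simp

/-- The first inequality of (4.18) in the proof of Theorem 4.2: the model heat kernel
is exponentially small away from the diagonal. -/
theorem stmt9 (ℓ : ℝ) (hℓ : 0 < ℓ) : ∃ c : ℝ, 0 < c ∧ ∀ (r t Ω : ℝ), 0 < r →
    0 < t → t ≤ 1 → Ω ∈ Set.Icc (9/10 : ℝ) (10/9) →
    (∫ p in {p : EuclideanSpace ℝ (Fin 3) | ℓ ≤ ‖p‖},
        (Real.exp ((Ω ^ 2)⁻¹ * r * t) * kappa r t Ω 0 p) ^ 2) ≤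
      c * (1 + r ^ 2 * t ^ 2) * Real.exp (-1 / (c * t)) := by
  set G : ℝ := ∫ p : EuclideanSpace ℝ (Fin 3), Real.exp (-(1 / 10) * ‖p‖ ^ 2) with hG_def
  have hG : 0 ≤ G := integral_nonneg fun p => (Real.exp_pos _).le
  have hint := integrable_exp_neg_mul_sq_norm (ι := Fin 3) (b := 1 / 10) (by norm_num)
  obtain ⟨a, ha_def⟩ : ∃ a : ℝ, a = ℓ ^ 2 / 20 := ⟨_, rfl⟩
  have ha : 0 < a := by rw [ha_def]; positivity
  refine ⟨96 * (a⁻¹) ^ 3 * G + a⁻¹, by positivity, fun r t Ω hr ht ht1 hΩ => ?_⟩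
  set c := 96 * (a⁻¹) ^ 3 * G + a⁻¹ with hc_def
  have hc : a⁻¹ ≤ c := le_add_of_nonneg_left (by positivity)
  set K := 16 * (1 + r ^ 2 * t ^ 2) * (6 * (a⁻¹) ^ 3 * Real.exp (-(a / t))) with hK_def
  have hK : 0 ≤ K := by positivity
  have hbound : ∀ p ∈ {p : EuclideanSpace ℝ (Fin 3) | ℓ ≤ ‖p‖},
      (Real.exp ((Ω ^ 2)⁻¹ * r * t) * kappa r t Ω 0 p) ^ 2 ≤
        K * Real.exp (-(1 / 10) * ‖p‖ ^ 2) := by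
    intro p hp
    have hp' : ℓ ^ 2 ≤ ‖p‖ ^ 2 := pow_le_pow_left₀ hℓ.le hp 2
    have hexp : Real.exp (-(‖p‖ ^ 2 / (5 * t))) ≤
        Real.exp (-(2 * a / t)) * Real.exp (-(1 / 10) * ‖p‖ ^ 2) := by
      rw [← Real.exp_add, Real.exp_le_exp]
      have h1 : 2 * a / t ≤ ‖p‖ ^ 2 / 10 / t := by gcongr; linarith
      have h2 : ‖p‖ ^ 2 / 10 ≤ ‖p‖ ^ 2 / 10 / t := le_div_self (by positivity) ht ht1
      have h3 : ‖p‖ ^ 2 / (5 * t) = ‖p‖ ^ 2 / 10 / t + ‖p‖ ^ 2 / 10 / t := by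
        field_simp; ring
      linarith
    calc _ ≤ 16 * (1 + r ^ 2 * t ^ 2) * (t⁻¹) ^ 3 * Real.exp (-(‖p‖ ^ 2 / (5 * t))) :=
          sq_exp_mul_kappa_le hr ht hΩ p
      _ ≤ 16 * (1 + r ^ 2 * t ^ 2) * (t⁻¹) ^ 3 *
            (Real.exp (-(2 * a / t)) * Real.exp (-(1 / 10) * ‖p‖ ^ 2)) := by gcongr
      _ = 16 * (1 + r ^ 2 * t ^ 2) * ((t⁻¹) ^ 3 * Real.exp (-(2 * a / t))) *
            Real.exp (-(1 / 10) * ‖p‖ ^ 2) := by ring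
      _ ≤ K * Real.exp (-(1 / 10) * ‖p‖ ^ 2) := by
          rw [hK_def]
          gcongr 16 * (1 + r ^ 2 * t ^ 2) * ?_ * _
          exact inv_pow_three_mul_exp_le ha ht
  have hS : MeasurableSet {p : EuclideanSpace ℝ (Fin 3) | ℓ ≤ ‖p‖} :=
    measurableSet_le measurable_const measurable_norm
  have hdecay : Real.exp (-(a / t)) ≤ Real.exp (-1 / (c * t)) := by
    have hca : c⁻¹ ≤ a := inv_le_of_inv_le₀ ha hc
    have h : c⁻¹ / t ≤ a / t := by gcongr
    rw [Real.exp_le_exp, show -1 / (c * t) = -(c⁻¹ / t) by field_simp]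
    linarith
  calc _ ≤ ∫ p in {p : EuclideanSpace ℝ (Fin 3) | ℓ ≤ ‖p‖},
          K * Real.exp (-(1 / 10) * ‖p‖ ^ 2) :=
        integral_mono_of_nonneg (Filter.Eventually.of_forall fun p => sq_nonneg _)
          (hint.const_mul K).integrableOn (ae_restrict_of_forall_mem hS hbound)
    _ ≤ ∫ p : EuclideanSpace ℝ (Fin 3), K * Real.exp (-(1 / 10) * ‖p‖ ^ 2) :=
        setIntegral_le_integral (hint.const_mul K)
          (Filter.Eventually.of_forall fun p => mul_nonneg hK (Real.exp_pos _).le)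
    _ = 96 * (a⁻¹) ^ 3 * G * (1 + r ^ 2 * t ^ 2) * Real.exp (-(a / t)) := by
        rw [integral_const_mul, ← hG_def, hK_def]; ring
    _ ≤ c * (1 + r ^ 2 * t ^ 2) * Real.exp (-1 / (c * t)) := by
        gcongr
        exact le_add_of_nonneg_right (by positivity)
end

section
/- For all natural numbers m and n there is a constant c > 0 such that for all r > 0, t > 0, Ω ∈ [9/10, 10/9], and all p₂ ∈ ℝ³, one has ∫₀^t ( ∫_{ℝ³} s^{(m−1)/2}·κ_{r,Ω}(s; p₁, p₂) · (t−s)^{(n−1)/2}·κ_{r,Ω}(t−s; 0, p₁) dp₁ ) ds ≤ c·t^{(m+n)/2}·κ_{r,Ω}(t; 0, p₂/2). -/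
open MeasureTheory Real

theorem integral_exp_neg_mul_sq_sub_mul_exp {a b : ℝ} (hab : a + b ≠ 0) (c : ℝ) :
    ∫ x : ℝ, exp (-a * (x - c) ^ 2) * exp (-b * x ^ 2) =
      √(π / (a + b)) * exp (-(a * b / (a + b)) * c ^ 2) := by
  have h (x : ℝ) : exp (-a * (x - c) ^ 2) * exp (-b * x ^ 2) =
      exp (-(a + b) * (x - a / (a + b) * c) ^ 2) * exp (-(a * b / (a + b)) * c ^ 2) := by
    rw [← exp_add, ← exp_add]
    congr 1
    field_simp
    ring
  simp_rw [h]
  rw [integral_mul_const,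
    integral_sub_right_eq_self (fun x : ℝ => exp (-(a + b) * x ^ 2)) (a / (a + b) * c),
    integral_gaussian]

theorem EuclideanSpace.integral_prod {n : ℕ} (f : Fin n → ℝ → ℝ) :
    ∫ p : EuclideanSpace ℝ (Fin n), ∏ i, f i (p i) = ∏ i, ∫ x, f i x := by
  rw [← integral_fintype_prod_volume_eq_prod]
  exact (PiLp.volume_preserving_ofLp (Fin n)).integral_comp
    (MeasurableEquiv.toLp 2 (Fin n → ℝ)).symm.measurableEmbedding (fun x => ∏ i, f i (x i))

theorem coth_add_coth {x y : ℝ} (hx : 0 < x) (hy : 0 < y) :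
    cosh x / sinh x + cosh y / sinh y = sinh (x + y) / (sinh x * sinh y) := by
  have := (sinh_pos_iff.2 hx).ne'
  have := (sinh_pos_iff.2 hy).ne'
  rw [sinh_add]
  field_simp
  ring

theorem cosh_add_le_two_mul (x y : ℝ) : cosh (x + y) ≤ 2 * (cosh x * cosh y) := by
  have h := cosh_pos (x - y)
  rw [cosh_sub] at h
  rw [cosh_add]
  linarith

theorem kappa_normalization {s u Ω : ℝ} (hs : 0 < s) (hu : 0 < u) (hΩ : 0 < Ω) :
    (4 * π) ^ (-(3 : ℝ) / 2) * Ω * s ^ (-(1 : ℝ) / 2) *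
        ((4 * π) ^ (-(3 : ℝ) / 2) * Ω * u ^ (-(1 : ℝ) / 2)) *
        (4 * π * √(π / (Ω ^ 2 / (4 * s) + Ω ^ 2 / (4 * u)))) =
      (4 * π) ^ (-(3 : ℝ) / 2) * Ω * (s + u) ^ (-(1 : ℝ) / 2) := by
  have hpow {x : ℝ} (hx : 0 < x) : x ^ (-(1 : ℝ) / 2) = (√x)⁻¹ := by
    rw [sqrt_eq_rpow, ← rpow_neg hx.le, neg_div]
  have hpi : (4 * π) ^ (-(3 : ℝ) / 2) = (4 * π * √(4 * π))⁻¹ := by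
    rw [sqrt_eq_rpow, ← rpow_one_add' (by positivity) (by norm_num), ← rpow_neg (by positivity)]
    norm_num
  have hsqrt : √(π / (Ω ^ 2 / (4 * s) + Ω ^ 2 / (4 * u))) =
      √(4 * π) * √s * √u / (Ω * √(s + u)) := by
    rw [show π / (Ω ^ 2 / (4 * s) + Ω ^ 2 / (4 * u)) = 4 * π * s * u / (Ω ^ 2 * (s + u)) by
      field_simp; ring, sqrt_div (by positivity), sqrt_mul (by positivity),
      sqrt_mul (by positivity), sqrt_mul (by positivity) (s + u), sqrt_sq hΩ.le]
  rw [hpow hs, hpow hu, hpow (add_pos hs hu), hpi, hsqrt]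
  have : 0 < √(4 * π) := by positivity
  field_simp

theorem kappa_nonneg {r t Ω : ℝ} (hr : 0 ≤ r) (ht : 0 ≤ t) (hΩ : 0 ≤ Ω)
    (p q : EuclideanSpace ℝ (Fin 3)) : 0 ≤ kappa r t Ω p q := by
  have : 0 ≤ sinh ((Ω ^ 2)⁻¹ * r * t) := sinh_nonneg_iff.2 (by positivity)
  unfold kappa
  positivity

theorem integral_kappa_mul_kappa_le {r s u Ω : ℝ} (hr : 0 < r) (hs : 0 < s) (hu : 0 < u)
    (hΩ : 0 < Ω) (q : EuclideanSpace ℝ (Fin 3)) :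
    ∫ p, kappa r s Ω p q * kappa r u Ω 0 p ≤ kappa r (s + u) Ω 0 ((2 : ℝ)⁻¹ • q) := by
  set α := (Ω ^ 2)⁻¹ * r * s with hα
  set β := (Ω ^ 2)⁻¹ * r * u with hβ
  have hα0 : 0 < α := by positivity
  have hβ0 : 0 < β := by positivity
  have hγ : (Ω ^ 2)⁻¹ * r * (s + u) = α + β := by rw [hα, hβ]; ring
  have hsα := sinh_pos_iff.2 hα0
  have hsβ := sinh_pos_iff.2 hβ0
  have hsγ := sinh_pos_iff.2 (add_pos hα0 hβ0)
  have hcα := cosh_pos α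
  have hcβ := cosh_pos β
  set a := r / 4 * (cosh α / sinh α) with ha
  set b := r / 4 * (cosh β / sinh β) with hb
  set A := Ω ^ 2 / (4 * s) with hA
  set B := Ω ^ 2 / (4 * u) with hB
  have hab : a + b = r / 4 * (sinh (α + β) / (sinh α * sinh β)) := by
    rw [← coth_add_coth hα0 hβ0, ha, hb]; ring
  have hab0 : 0 < a + b := by positivity
  have hAB0 : 0 < A + B := by positivity
  have hdiv : a * b / (a + b) = r / 4 * (cosh α * cosh β / sinh (α + β)) := by
    rw [hab, ha, hb]; field_simp
  have hDIV : A * B / (A + B) = Ω ^ 2 / (4 * (s + u)) := by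
    rw [hA, hB]; field_simp; ring
  let e : Fin 3 → ℝ := ![a, a, A]
  let f : Fin 3 → ℝ := ![b, b, B]
  have hprod (p : EuclideanSpace ℝ (Fin 3)) : kappa r s Ω p q * kappa r u Ω 0 p =
      ((4 * π) ^ (-(3 : ℝ) / 2) * Ω * s ^ (-(1 : ℝ) / 2) * (r / sinh α) *
        ((4 * π) ^ (-(3 : ℝ) / 2) * Ω * u ^ (-(1 : ℝ) / 2) * (r / sinh β))) *
      ∏ i, exp (-e i * (p i - q i) ^ 2) * exp (-f i * p i ^ 2) := by
    have h1 : exp (-(Ω ^ 2 * (p 2 - q 2) ^ 2) / (4 * s)) = exp (-A * (p 2 - q 2) ^ 2) := by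
      congr 1; rw [hA]; ring
    have h2 : exp (-(Ω ^ 2 * ((0 : EuclideanSpace ℝ (Fin 3)) 2 - p 2) ^ 2) / (4 * u)) =
        exp (-B * p 2 ^ 2) := by
      congr 1; rw [hB, PiLp.zero_apply]; ring
    have h3 : exp (-(r / 4) * (cosh α / sinh α) * ((p 0 - q 0) ^ 2 + (p 1 - q 1) ^ 2)) =
        exp (-a * (p 0 - q 0) ^ 2) * exp (-a * (p 1 - q 1) ^ 2) := by
      rw [← exp_add]; congr 1; rw [ha]; ring
    have h4 : exp (-(r / 4) * (cosh β / sinh β) *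
          (((0 : EuclideanSpace ℝ (Fin 3)) 0 - p 0) ^ 2 +
            ((0 : EuclideanSpace ℝ (Fin 3)) 1 - p 1) ^ 2)) =
        exp (-b * p 0 ^ 2) * exp (-b * p 1 ^ 2) := by
      rw [← exp_add]; congr 1; rw [hb, PiLp.zero_apply, PiLp.zero_apply]; ring
    simp only [kappa, ← hα, ← hβ]
    rw [h1, h2, h3, h4, Fin.prod_univ_three]
    simp only [e, f, Matrix.cons_val]
    ring
  simp_rw [hprod]
  rw [integral_const_mul, EuclideanSpace.integral_prod
    (fun i x => exp (-e i * (x - q i) ^ 2) * exp (-f i * x ^ 2)), Fin.prod_univ_three]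
  simp only [e, f, Matrix.cons_val]
  rw [integral_exp_neg_mul_sq_sub_mul_exp hab0.ne', integral_exp_neg_mul_sq_sub_mul_exp hab0.ne',
    integral_exp_neg_mul_sq_sub_mul_exp hAB0.ne', hdiv, hDIV]
  have hsq : √(π / (a + b)) * √(π / (a + b)) * (r / sinh α * (r / sinh β)) =
      4 * π * (r / sinh (α + β)) := by
    rw [mul_self_sqrt (by positivity), hab]; field_simp
  set D := r / 4 * (cosh α * cosh β / sinh (α + β)) with hD
  have hcoef := kappa_normalization hs hu hΩ
  rw [← hA, ← hB] at hcoef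
  calc
    _ = ((4 * π) ^ (-(3 : ℝ) / 2) * Ω * s ^ (-(1 : ℝ) / 2) *
          ((4 * π) ^ (-(3 : ℝ) / 2) * Ω * u ^ (-(1 : ℝ) / 2)) *
          ((√(π / (a + b)) * √(π / (a + b)) * (r / sinh α * (r / sinh β))) * √(π / (A + B)))) *
        exp (-(Ω ^ 2 / (4 * (s + u))) * q 2 ^ 2) *
        (exp (-D * q 0 ^ 2) * exp (-D * q 1 ^ 2)) := by ring
    _ = (4 * π) ^ (-(3 : ℝ) / 2) * Ω * (s + u) ^ (-(1 : ℝ) / 2) *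
        exp (-(Ω ^ 2 / (4 * (s + u))) * q 2 ^ 2) * (r / sinh (α + β)) *
        exp (-D * q 0 ^ 2 + -D * q 1 ^ 2) := by
      rw [hsq, ← hcoef, exp_add]; ring
    _ ≤ _ := by
      simp only [kappa, hγ, PiLp.zero_apply, PiLp.smul_apply, smul_eq_mul]
      gcongr ?_ * exp ?_ * _ * exp ?_
      · have : 0 ≤ Ω ^ 2 / (4 * (s + u)) * q 2 ^ 2 := by positivity
        calc
          _ ≤ -(Ω ^ 2 / (4 * (s + u)) * q 2 ^ 2) / 4 := by linarith
          _ = _ := by ring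
      · have h : cosh (α + β) / sinh (α + β) ≤ 4 * (cosh α * cosh β / sinh (α + β)) := by
          rw [← mul_div_assoc]
          gcongr
          linarith [cosh_add_le_two_mul α β, mul_pos hcα hcβ]
        have := mul_le_mul_of_nonneg_left h
          (show 0 ≤ r / 4 * (q 0 ^ 2 + q 1 ^ 2) / 4 by positivity)
        rw [hD]
        linarith

theorem intervalIntegrable_rpow_mul_one_sub_rpow {p q : ℝ} (hp : -1 < p) (hq : -1 < q) :
    IntervalIntegrable (fun x : ℝ => x ^ p * (1 - x) ^ q) volume 0 1 := by
  have h := (Complex.betaIntegral_convergent (u := (p + 1 : ℝ)) (v := (q + 1 : ℝ))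
    (by simp; linarith) (by simp; linarith)).norm
  refine h.congr fun x hx => ?_
  rw [Set.uIoc_of_le zero_le_one] at hx
  have hx1 : 0 ≤ 1 - x := sub_nonneg.2 hx.2
  have key : (x : ℂ) ^ (((p + 1 : ℝ) : ℂ) - 1) * (1 - (x : ℂ)) ^ (((q + 1 : ℝ) : ℂ) - 1) =
      ((x ^ p * (1 - x) ^ q : ℝ) : ℂ) := by
    push_cast [Complex.ofReal_cpow hx.1.le, Complex.ofReal_cpow hx1]
    simp
  simp only [key, Complex.norm_real, norm_eq_abs]
  exact abs_of_nonneg (mul_nonneg (rpow_nonneg hx.1.le _) (rpow_nonneg hx1 _))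

theorem rpow_mul_sub_rpow_eq {p q t x : ℝ} (ht : 0 < t) (hx : 0 ≤ x) (hxt : x ≤ t) :
    x ^ p * (t - x) ^ q = t ^ (p + q) * ((t⁻¹ * x) ^ p * (1 - t⁻¹ * x) ^ q) := by
  rw [show 1 - t⁻¹ * x = t⁻¹ * (t - x) by field_simp, mul_rpow (by positivity) hx,
    mul_rpow (by positivity) (sub_nonneg.2 hxt), rpow_add ht, inv_rpow ht.le, inv_rpow ht.le]
  have := (rpow_pos_of_pos ht p).ne'
  have := (rpow_pos_of_pos ht q).ne'
  field_simp

theorem intervalIntegrable_rpow_mul_sub_rpow {p q t : ℝ} (hp : -1 < p) (hq : -1 < q)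
    (ht : 0 < t) : IntervalIntegrable (fun x : ℝ => x ^ p * (t - x) ^ q) volume 0 t := by
  have h := ((intervalIntegrable_rpow_mul_one_sub_rpow hp hq).comp_mul_left
    (c := t⁻¹)).const_mul (t ^ (p + q))
  simp only [zero_div, one_div, inv_inv] at h
  refine h.congr fun x hx => ?_
  rw [Set.uIoc_of_le ht.le] at hx
  exact (rpow_mul_sub_rpow_eq ht hx.1.le hx.2).symm

theorem integral_rpow_mul_sub_rpow {p q t : ℝ} (ht : 0 < t) :
    ∫ x in (0 : ℝ)..t, x ^ p * (t - x) ^ q =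
      t ^ (p + q + 1) * ∫ x in (0 : ℝ)..1, x ^ p * (1 - x) ^ q := by
  have h : ∫ x in (0 : ℝ)..t, x ^ p * (t - x) ^ q =
      ∫ x in (0 : ℝ)..t, t ^ (p + q) * ((t⁻¹ * x) ^ p * (1 - t⁻¹ * x) ^ q) := by
    refine intervalIntegral.integral_congr fun x hx => ?_
    rw [Set.uIcc_of_le ht.le] at hx
    exact rpow_mul_sub_rpow_eq ht hx.1 hx.2
  rw [h, intervalIntegral.integral_const_mul,
    intervalIntegral.integral_comp_mul_left (fun x => x ^ p * (1 - x) ^ q) (inv_ne_zero ht.ne'),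
    rpow_add_one ht.ne', inv_inv, mul_zero, inv_mul_cancel₀ ht.ne', smul_eq_mul, mul_assoc]

/-- The convolution estimate (4.16) in the proof of Theorem 4.2. -/
theorem stmt11 (m n : ℕ) : ∃ c : ℝ, 0 < c ∧
    ∀ (r t Ω : ℝ), 0 < r → 0 < t → Ω ∈ Set.Icc (9/10 : ℝ) (10/9) →
    ∀ p₂ : EuclideanSpace ℝ (Fin 3),
    (∫ s in (0:ℝ)..t, ∫ p₁ : EuclideanSpace ℝ (Fin 3),
        s ^ (((m : ℝ) - 1) / 2) * kappa r s Ω p₁ p₂ *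
          ((t - s) ^ (((n : ℝ) - 1) / 2) * kappa r (t - s) Ω 0 p₁)) ≤
      c * t ^ (((m : ℝ) + n) / 2) * kappa r t Ω 0 ((2:ℝ)⁻¹ • p₂) := by
  set a : ℝ := ((m : ℝ) - 1) / 2 with ha
  set b : ℝ := ((n : ℝ) - 1) / 2 with hb
  have ha1 : -1 < a := by rw [ha]; linarith [(m.cast_nonneg : (0 : ℝ) ≤ m)]
  have hb1 : -1 < b := by rw [hb]; linarith [(n.cast_nonneg : (0 : ℝ) ≤ n)]
  refine ⟨∫ x in (0 : ℝ)..1, x ^ a * (1 - x) ^ b, ?_, ?_⟩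
  · exact intervalIntegral.intervalIntegral_pos_of_pos_on
      (intervalIntegrable_rpow_mul_one_sub_rpow ha1 hb1)
      (fun x hx => mul_pos (rpow_pos_of_pos hx.1 _) (rpow_pos_of_pos (sub_pos.2 hx.2) _))
      zero_lt_one
  intro r t Ω hr ht hΩ p₂
  have hΩ0 : 0 < Ω := by linarith [hΩ.1]
  set K := kappa r t Ω 0 ((2 : ℝ)⁻¹ • p₂)
  calc
    _ ≤ ∫ s in (0 : ℝ)..t, s ^ a * (t - s) ^ b * K := by
      have hint := (intervalIntegrable_rpow_mul_sub_rpow ha1 hb1 ht).mul_const K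
      rw [intervalIntegrable_iff_integrableOn_Ioo_of_le ht.le] at hint
      rw [intervalIntegral.integral_of_le ht.le, intervalIntegral.integral_of_le ht.le,
        integral_Ioc_eq_integral_Ioo, integral_Ioc_eq_integral_Ioo]
      refine integral_mono_of_nonneg ?_ hint ?_
      · filter_upwards [ae_restrict_mem measurableSet_Ioo] with s hs
        have hts : 0 ≤ t - s := sub_nonneg.2 hs.2.le
        exact integral_nonneg fun p => mul_nonneg
          (mul_nonneg (rpow_nonneg hs.1.le _) (kappa_nonneg hr.le hs.1.le hΩ0.le _ _))
          (mul_nonneg (rpow_nonneg hts _) (kappa_nonneg hr.le hts hΩ0.le _ _))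
      · filter_upwards [ae_restrict_mem measurableSet_Ioo] with s hs
        have hts : 0 < t - s := sub_pos.2 hs.2
        have hle := integral_kappa_mul_kappa_le hr hs.1 hts hΩ0 p₂
        rw [add_sub_cancel] at hle
        refine (integral_congr_ae (.of_forall fun p => mul_mul_mul_comm _ _ _ _)).trans_le ?_
        rw [integral_const_mul]
        exact mul_le_mul_of_nonneg_left hle
          (mul_nonneg (rpow_nonneg hs.1.le _) (rpow_nonneg hts.le _))
    _ = _ := by
      rw [intervalIntegral.integral_mul_const, integral_rpow_mul_sub_rpow ht,
        show a + b + 1 = ((m : ℝ) + n) / 2 by rw [ha, hb]; ring]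
      ring
end

section
/- For every natural number m there is a constant c > 0 such that for all r > 0, t > 0, Ω ∈ [9/10, 10/9], and all p ∈ ℝ³, one has |p|^m · κ_{r,Ω}(t; 0, p) ≤ c·t^{m/2}·κ_{r,Ω}(t; 0, p/2). -/
open MeasureTheory Real

theorem sinh_le_mul_cosh {s : ℝ} (hs : 0 ≤ s) : Real.sinh s ≤ s * Real.cosh s := by
  have hd : ∀ x : ℝ, HasDerivAt (fun x => x * Real.cosh x - Real.sinh x) (x * Real.sinh x) x := by
    intro x
    refine (((hasDerivAt_id' x).mul (Real.hasDerivAt_cosh x)).sub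
      (Real.hasDerivAt_sinh x)).congr_deriv ?_
    ring
  have hmono : MonotoneOn (fun x : ℝ => x * Real.cosh x - Real.sinh x) (Set.Ici 0) := by
    refine monotoneOn_of_deriv_nonneg (convex_Ici 0)
      (fun x _ => (hd x).continuousAt.continuousWithinAt)
      (fun x _ => (hd x).differentiableAt.differentiableWithinAt) fun x hx => ?_
    rw [interior_Ici] at hx
    have hx' : 0 ≤ x := le_of_lt hx
    rw [(hd x).deriv]
    exact mul_nonneg hx' (Real.sinh_nonneg_iff.mpr hx')
  have h := hmono (Set.self_mem_Ici) hs hs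
  simpa using h

theorem pow_le_mul_exp_sq_div_eight (m : ℕ) (u : ℝ) :
    u ^ m ≤ (1 + 8 ^ m * m.factorial) * Real.exp (u ^ 2 / 8) := by
  have h1 : (u ^ 2 / 8) ^ m / m.factorial ≤ Real.exp (u ^ 2 / 8) :=
    Real.pow_div_factorial_le_exp _ (by positivity) m
  have h2 : (1 : ℝ) ≤ Real.exp (u ^ 2 / 8) := Real.one_le_exp (by positivity)
  have hf : (0 : ℝ) < m.factorial := by exact_mod_cast m.factorial_pos
  rw [div_le_iff₀ hf, div_pow, div_le_iff₀ (by positivity)] at h1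
  have h3 : u ^ m ≤ 1 + (u ^ 2) ^ m := by
    rw [← pow_mul, mul_comm 2 m, pow_mul]
    nlinarith [sq_nonneg (u ^ m - 1)]
  linarith

theorem div_four_mul_le_mul_coth {r t Ω : ℝ} (hr : 0 < r) (ht : 0 < t) (hΩ : 0 < Ω) :
    Ω ^ 2 / (4 * t) ≤ r / 4 *
      (Real.cosh ((Ω ^ 2)⁻¹ * r * t) / Real.sinh ((Ω ^ 2)⁻¹ * r * t)) := by
  set s := (Ω ^ 2)⁻¹ * r * t with hs_def
  have hs : 0 < s := by positivity
  have hcoth : s⁻¹ ≤ Real.cosh s / Real.sinh s := by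
    rw [le_div_iff₀ (Real.sinh_pos_iff.mpr hs), inv_mul_le_iff₀ hs]
    exact sinh_le_mul_cosh hs.le
  calc Ω ^ 2 / (4 * t) = r / 4 * s⁻¹ := by rw [hs_def]; field_simp
    _ ≤ _ := by gcongr

theorem kappa_zero_le {r t Ω : ℝ} (hr : 0 < r) (ht : 0 < t)
    (hΩ : (9 / 10 : ℝ) ≤ Ω) (p : EuclideanSpace ℝ (Fin 3)) :
    kappa r t Ω 0 p ≤
      Real.exp (-((‖p‖ / √t) ^ 2 / 8)) * kappa r t Ω 0 ((2 : ℝ)⁻¹ • p) := by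
  have hΩ0 : 0 < Ω := by linarith
  have hk := div_four_mul_le_mul_coth hr ht hΩ0
  have hS : 0 < Real.sinh ((Ω ^ 2)⁻¹ * r * t) := Real.sinh_pos_iff.mpr (by positivity)
  have hn : ‖p‖ ^ 2 = p 0 ^ 2 + p 1 ^ 2 + p 2 ^ 2 := by
    simp [EuclideanSpace.norm_sq_eq, Fin.sum_univ_three]
  have hu : (‖p‖ / √t) ^ 2 / 8 = (p 0 ^ 2 + p 1 ^ 2 + p 2 ^ 2) * (1 / (8 * t)) := by
    rw [div_pow, Real.sq_sqrt ht.le, hn]; field_simp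
  simp only [kappa, PiLp.zero_apply, PiLp.smul_apply, smul_eq_mul]
  rw [hu]
  set S := Real.sinh ((Ω ^ 2)⁻¹ * r * t)
  set C := Real.cosh ((Ω ^ 2)⁻¹ * r * t) / S
  set A := (4 * Real.pi) ^ (-(3:ℝ)/2) * Ω * t ^ (-(1:ℝ)/2)
  have hA : 0 ≤ A := by positivity
  have hexp : Real.exp (-(Ω ^ 2 * (0 - p 2) ^ 2) / (4 * t)) *
        Real.exp (-(r / 4) * C * ((0 - p 0) ^ 2 + (0 - p 1) ^ 2)) ≤
      Real.exp (-((p 0 ^ 2 + p 1 ^ 2 + p 2 ^ 2) * (1 / (8 * t)))) *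
        (Real.exp (-(Ω ^ 2 * (0 - 2⁻¹ * p 2) ^ 2) / (4 * t)) *
        Real.exp (-(r / 4) * C * ((0 - 2⁻¹ * p 0) ^ 2 + (0 - 2⁻¹ * p 1) ^ 2))) := by
    simp only [← Real.exp_add]
    refine Real.exp_le_exp.mpr ?_
    have hw : 1 / (8 * t) ≤ 3 / 4 * (Ω ^ 2 / (4 * t)) := by
      rw [← mul_div_assoc, div_le_div_iff₀ (by positivity) (by positivity)]
      have : (9 / 10 : ℝ) ^ 2 ≤ Ω ^ 2 := by gcongr
      nlinarith
    have hz := mul_le_mul_of_nonneg_left hw (sq_nonneg (p 2))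
    have hxy := mul_le_mul_of_nonneg_left
      (hw.trans (mul_le_mul_of_nonneg_left hk (by norm_num : (0 : ℝ) ≤ 3 / 4)))
      (add_nonneg (sq_nonneg (p 0)) (sq_nonneg (p 1)))
    have e1 : ∀ z : ℝ, -(Ω ^ 2 * z ^ 2) / (4 * t) = -(z ^ 2 * (Ω ^ 2 / (4 * t))) := by
      intro z; ring
    rw [e1, e1]
    linarith
  have := mul_le_mul_of_nonneg_left hexp (mul_nonneg hA (div_pos hr hS).le)
  linarith

/-- The second of the four kernel properties in Step 3 of the proof of Theorem 4.2:
`|p|^m κ_{r,Ω}(t;0,p) ≤ c t^{m/2} κ_{r,Ω}(t;0,p/2)`. -/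
theorem stmt12 (m : ℕ) : ∃ c : ℝ, 0 < c ∧
    ∀ (r t Ω : ℝ), 0 < r → 0 < t → Ω ∈ Set.Icc (9/10 : ℝ) (10/9) →
    ∀ p : EuclideanSpace ℝ (Fin 3),
    ‖p‖ ^ m * kappa r t Ω 0 p ≤
      c * t ^ ((m : ℝ) / 2) * kappa r t Ω 0 ((2:ℝ)⁻¹ • p) := by
  refine ⟨1 + 8 ^ m * m.factorial, by positivity, fun r t Ω hr ht hΩ p => ?_⟩
  have hΩ0 : 0 < Ω := by linarith [hΩ.1]
  have hst : 0 < √t := Real.sqrt_pos.mpr ht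
  have hκ : 0 ≤ kappa r t Ω 0 ((2 : ℝ)⁻¹ • p) := by
    have hS : 0 < Real.sinh ((Ω ^ 2)⁻¹ * r * t) := Real.sinh_pos_iff.mpr (by positivity)
    unfold kappa
    positivity
  have htm : t ^ ((m : ℝ) / 2) = √t ^ m := by
    rw [Real.sqrt_eq_rpow, ← Real.rpow_mul_natCast ht.le]
    congr 1
    ring
  have hpow := pow_le_mul_exp_sq_div_eight m (‖p‖ / √t)
  set u := ‖p‖ / √t with hu
  have hp : ‖p‖ = √t * u := by rw [hu]; field_simp
  calc ‖p‖ ^ m * kappa r t Ω 0 p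
      ≤ ‖p‖ ^ m * (Real.exp (-(u ^ 2 / 8)) * kappa r t Ω 0 ((2 : ℝ)⁻¹ • p)) := by
        gcongr
        exact kappa_zero_le hr ht hΩ.1 p
    _ = √t ^ m * (u ^ m * Real.exp (-(u ^ 2 / 8))) * kappa r t Ω 0 ((2 : ℝ)⁻¹ • p) := by
        rw [hp, mul_pow]; ring
    _ ≤ √t ^ m * (1 + 8 ^ m * m.factorial) * kappa r t Ω 0 ((2 : ℝ)⁻¹ • p) := by
        gcongr
        rwa [Real.exp_neg, ← div_eq_mul_inv, div_le_iff₀ (Real.exp_pos _)]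
    _ = _ := by rw [htm]; ring
end

section
/- There is a universal constant c > 0 such that for all r > 0, t > 0, Ω ∈ [9/10, 10/9], and all p ∈ ℝ³, the gradient in the second variable satisfies ‖∇_p κ_{r,Ω}(t; 0, p)‖ ≤ c·( t^{−1/2} + r^{1/2} )·κ_{r,Ω}(t; 0, p/2). -/
open MeasureTheory Real

/-- An anisotropic Gaussian on `ℝ³` has a gradient whose norm is controlled by its coefficients. -/
theorem norm_fderiv_gaussian_le {C a b : ℝ} (hC : 0 ≤ C) (ha : 0 ≤ a) (hb : 0 ≤ b)
    (p : EuclideanSpace ℝ (Fin 3)) :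
    ‖fderiv ℝ (fun q : EuclideanSpace ℝ (Fin 3) =>
        C * Real.exp (-(a * q 2 ^ 2 + b * (q 0 ^ 2 + q 1 ^ 2)))) p‖ ≤
      C * (2 * (a * |p 2| + b * |p 0| + b * |p 1|) *
        Real.exp (-(a * p 2 ^ 2 + b * (p 0 ^ 2 + p 1 ^ 2)))) := by
  have h (i : Fin 3) : HasFDerivAt (fun q : EuclideanSpace ℝ (Fin 3) => q i)
      (EuclideanSpace.proj i : EuclideanSpace ℝ (Fin 3) →L[ℝ] ℝ) p :=
    (EuclideanSpace.proj i : EuclideanSpace ℝ (Fin 3) →L[ℝ] ℝ).hasFDerivAt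
  have hd := (((((h 2).pow 2).const_mul a).add
    ((((h 0).pow 2).add ((h 1).pow 2)).const_mul b)).neg.exp).const_mul C
  have he := hd.fderiv
  simp only [Pi.add_apply, Pi.neg_apply] at he
  refine ContinuousLinearMap.opNorm_le_bound _ (by positivity) fun v => ?_
  have hv (i : Fin 3) : |v i| ≤ ‖v‖ := PiLp.norm_apply_le v i
  have hcoord (i : Fin 3) {k : ℝ} (hk : 0 ≤ k) : |k * p i * v i| ≤ k * |p i| * ‖v‖ := by
    rw [abs_mul, abs_mul, abs_of_nonneg hk]
    exact mul_le_mul_of_nonneg_left (hv i) (by positivity)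
  have hsum : |a * p 2 * v 2 + b * p 0 * v 0 + b * p 1 * v 1| ≤
      (a * |p 2| + b * |p 0| + b * |p 1|) * ‖v‖ := by
    refine (abs_add_three _ _ _).trans ?_
    linarith [hcoord 2 ha, hcoord 0 hb, hcoord 1 hb]
  have hval : fderiv ℝ (fun q : EuclideanSpace ℝ (Fin 3) =>
        C * Real.exp (-(a * q 2 ^ 2 + b * (q 0 ^ 2 + q 1 ^ 2)))) p v =
      -(2 * C * Real.exp (-(a * p 2 ^ 2 + b * (p 0 ^ 2 + p 1 ^ 2)))) *
        (a * p 2 * v 2 + b * p 0 * v 0 + b * p 1 * v 1) := by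
    refine (DFunLike.congr_fun he v).trans ?_
    simp
    ring
  rw [hval, Real.norm_eq_abs, abs_mul, abs_neg, abs_of_nonneg (by positivity)]
  refine (mul_le_mul_of_nonneg_left hsum (by positivity)).trans_eq ?_
  ring

/-- Part of the Gaussian decay absorbs a linear factor. -/
theorem mul_abs_mul_exp_neg_le {a S z Q : ℝ} (ha : 0 ≤ a) (hS : 0 ≤ S) (haS : a ≤ S ^ 2)
    (hQ : a * z ^ 2 ≤ Q) : a * |z| * Real.exp (-Q) ≤ S * Real.exp (-(Q / 4)) := by
  have hQ0 : 0 ≤ Q := le_trans (by positivity) hQ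
  have h1 : a * |z| ≤ S * (3 / 4 * Q + 1) := by
    refine le_of_sq_le_sq ?_ (by positivity)
    calc (a * |z|) ^ 2 = a * (a * z ^ 2) := by rw [mul_pow, sq_abs]; ring
      _ ≤ S ^ 2 * Q := mul_le_mul haS hQ (by positivity) (by positivity)
      _ ≤ S ^ 2 * (3 / 4 * Q + 1) ^ 2 := by
        gcongr
        nlinarith [sq_nonneg Q]
      _ = (S * (3 / 4 * Q + 1)) ^ 2 := by ring
  have h2 : a * |z| ≤ S * Real.exp (3 / 4 * Q) :=
    h1.trans (mul_le_mul_of_nonneg_left (Real.add_one_le_exp _) hS)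
  calc a * |z| * Real.exp (-Q) ≤ S * Real.exp (3 / 4 * Q) * Real.exp (-Q) := by gcongr
    _ = S * Real.exp (-(Q / 4)) := by
      rw [mul_assoc, ← Real.exp_add]
      ring_nf

theorem cosh_div_sinh_le {u : ℝ} (hu : 0 < u) : Real.cosh u / Real.sinh u ≤ 1 + u⁻¹ := by
  have hs : 0 < Real.sinh u := Real.sinh_pos_iff.2 hu
  have h1 : u ≤ Real.sinh u := Real.self_le_sinh_iff.2 hu.le
  have h2 : Real.cosh u ≤ Real.sinh u + 1 := by
    have := Real.exp_le_one_iff.2 (neg_nonpos.2 hu.le)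
    linarith [Real.cosh_sub_sinh u]
  have h3 : 1 ≤ u⁻¹ * Real.sinh u := by
    rw [inv_mul_eq_div, one_le_div hu]
    exact h1
  rw [div_le_iff₀ hs]
  linarith

/-- The `m = 1` case of the first kernel property in Step 3 of the proof of Theorem 4.2:
a gradient bound in the second variable,
`‖∇_p κ_{r,Ω}(t;0,p)‖ ≤ c (t^{-1/2} + r^{1/2}) κ_{r,Ω}(t;0,p/2)`. -/
theorem stmt13 : ∃ c : ℝ, 0 < c ∧
    ∀ (r t Ω : ℝ), 0 < r → 0 < t → Ω ∈ Set.Icc (9/10 : ℝ) (10/9) →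
    ∀ p : EuclideanSpace ℝ (Fin 3),
    ‖fderiv ℝ (fun q : EuclideanSpace ℝ (Fin 3) => kappa r t Ω 0 q) p‖ ≤
      c * (t ^ (-(1:ℝ)/2) + r ^ ((1:ℝ)/2)) * kappa r t Ω 0 ((2:ℝ)⁻¹ • p) := by
  refine ⟨6, by norm_num, fun r t Ω hr ht hΩ p => ?_⟩
  obtain ⟨hΩ1, hΩ2⟩ := hΩ
  have hΩ0 : 0 < Ω := by linarith
  have hΩsq : Ω ^ 2 ≤ 4 := by nlinarith
  set u := (Ω ^ 2)⁻¹ * r * t with hu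
  have hu0 : 0 < u := by positivity
  have hs : 0 < Real.sinh u := Real.sinh_pos_iff.2 hu0
  have hc : 0 < Real.cosh u := Real.cosh_pos u
  set C := (4 * Real.pi) ^ (-(3:ℝ)/2) * Ω * t ^ (-(1:ℝ)/2) * (r / Real.sinh u) with hC
  set a := Ω ^ 2 / (4 * t) with ha
  set b := r / 4 * (Real.cosh u / Real.sinh u) with hb
  set S := t ^ (-(1:ℝ)/2) + r ^ ((1:ℝ)/2) with hS
  have hC0 : 0 ≤ C := by positivity
  have ha0 : 0 ≤ a := by positivity
  have hb0 : 0 ≤ b := by positivity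
  have hS0 : 0 ≤ S := by positivity
  have hk (q : EuclideanSpace ℝ (Fin 3)) : kappa r t Ω 0 q =
      C * Real.exp (-(a * q 2 ^ 2 + b * (q 0 ^ 2 + q 1 ^ 2))) := by
    rw [neg_add, Real.exp_add, kappa, ← hu]
    simp only [PiLp.zero_apply, zero_sub, neg_sq]
    rw [hC, ha, hb]
    ring_nf
  have hSsq : t⁻¹ + r ≤ S ^ 2 := by
    have h1 : (t ^ (-(1:ℝ)/2)) ^ 2 = t⁻¹ := by
      rw [← Real.rpow_natCast, ← Real.rpow_mul ht.le, ← Real.rpow_neg_one]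
      norm_num
    have h2 : (r ^ ((1:ℝ)/2)) ^ 2 = r := by
      rw [← Real.rpow_natCast, ← Real.rpow_mul hr.le]
      norm_num
    have h3 : 0 ≤ t ^ (-(1:ℝ)/2) * r ^ ((1:ℝ)/2) := by positivity
    rw [hS, add_sq, h1, h2]
    linarith
  have hat : a ≤ t⁻¹ := by
    rw [ha, inv_eq_one_div, div_le_div_iff₀ (by positivity) ht]
    nlinarith
  have haS : a ≤ S ^ 2 := by linarith
  have hbS : b ≤ S ^ 2 := by
    have h1 : b ≤ r / 4 * (1 + u⁻¹) :=
      mul_le_mul_of_nonneg_left (cosh_div_sinh_le hu0) (by positivity)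
    have h2 : r / 4 * (1 + u⁻¹) = r / 4 + a := by
      rw [hu, ha]
      field_simp
    linarith
  simp only [hk]
  refine (norm_fderiv_gaussian_le hC0 ha0 hb0 p).trans ?_
  set Q := a * p 2 ^ 2 + b * (p 0 ^ 2 + p 1 ^ 2) with hQ
  have hq : a * ((2:ℝ)⁻¹ • p) 2 ^ 2 +
      b * (((2:ℝ)⁻¹ • p) 0 ^ 2 + ((2:ℝ)⁻¹ • p) 1 ^ 2) = Q / 4 := by
    simp only [PiLp.smul_apply, smul_eq_mul]
    rw [hQ]
    ring
  have h0 : 0 ≤ b * p 0 ^ 2 := by positivity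
  have h1 : 0 ≤ b * p 1 ^ 2 := by positivity
  have h2 : 0 ≤ a * p 2 ^ 2 := by positivity
  have e0 := mul_abs_mul_exp_neg_le (z := p 0) (Q := Q) hb0 hS0 hbS (by linarith)
  have e1 := mul_abs_mul_exp_neg_le (z := p 1) (Q := Q) hb0 hS0 hbS (by linarith)
  have e2 := mul_abs_mul_exp_neg_le (z := p 2) (Q := Q) ha0 hS0 haS (by linarith)
  rw [hq]
  calc C * (2 * (a * |p 2| + b * |p 0| + b * |p 1|) * Real.exp (-Q))
      ≤ C * (6 * (S * Real.exp (-(Q / 4)))) := mul_le_mul_of_nonneg_left (by linarith) hC0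
    _ = 6 * S * (C * Real.exp (-(Q / 4))) := by ring
end

section
/- There is a universal constant c > 0 such that for all r > 0, t > 0, and Ω ∈ [9/10, 10/9], one has r·e^{−Ω⁻²·r·t} / sinh(Ω⁻²·r·t) ≤ c·( t^{−1} + r )·e^{−r·t/2}. -/
open Real

/-- A lower bound for `sinh` with exponential weights. -/
theorem mul_exp_neg_le_two_mul_exp_neg_half_mul_sinh {s x : ℝ} (hs : 0 ≤ s)
    (hx : 3 / 4 * s ≤ x) :
    s * Real.exp (-x) ≤ 2 * (Real.exp (-s / 2) * Real.sinh x) := by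
  have h1 : Real.exp (-s / 2) ≤ 1 := Real.exp_le_one_iff.2 (by linarith)
  have h2 := Real.add_one_le_exp (2 * x - s / 2)
  have h3 : Real.exp (-s / 2) * Real.exp x = Real.exp (2 * x - s / 2) * Real.exp (-x) := by
    rw [← Real.exp_add, ← Real.exp_add]
    ring_nf
  calc s * Real.exp (-x)
      ≤ (Real.exp (2 * x - s / 2) - Real.exp (-s / 2)) * Real.exp (-x) := by
        gcongr
        linarith
    _ = 2 * (Real.exp (-s / 2) * Real.sinh x) := by
        rw [Real.sinh_eq, sub_mul, ← h3]
        ring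

/-- The core of inequality (4.19) in Step 4 of the proof of Theorem 4.2:
`r e^{-Ω⁻²rt}/sinh(Ω⁻²rt) ≤ c(t⁻¹ + r)e^{-rt/2}`. -/
theorem stmt14 : ∃ c : ℝ, 0 < c ∧
    ∀ (r t Ω : ℝ), 0 < r → 0 < t → Ω ∈ Set.Icc (9/10 : ℝ) (10/9) →
    r * Real.exp (-((Ω ^ 2)⁻¹ * r * t)) / Real.sinh ((Ω ^ 2)⁻¹ * r * t) ≤
      c * (t⁻¹ + r) * Real.exp (-(r * t) / 2) := by
  refine ⟨2, by norm_num, fun r t Ω hr ht ⟨hΩ₁, hΩ₂⟩ => ?_⟩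
  have hΩ : 0 < Ω := by linarith
  have ha : 3 / 4 ≤ (Ω ^ 2)⁻¹ := by
    rw [le_inv_comm₀ (by norm_num) (by positivity)]
    nlinarith
  have hx : 3 / 4 * (r * t) ≤ (Ω ^ 2)⁻¹ * r * t := by
    rw [mul_assoc]
    gcongr
  have hsinh : 0 < Real.sinh ((Ω ^ 2)⁻¹ * r * t) := Real.sinh_pos_iff.2 (by positivity)
  have key := mul_exp_neg_le_two_mul_exp_neg_half_mul_sinh (by positivity) hx
  rw [div_le_iff₀ hsinh]
  generalize (Ω ^ 2)⁻¹ * r * t = x at *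
  calc r * Real.exp (-x) = t⁻¹ * (r * t * Real.exp (-x)) := by field_simp
    _ ≤ (t⁻¹ + r) * (2 * (Real.exp (-(r * t) / 2) * Real.sinh x)) := by
        gcongr
        linarith
    _ = 2 * (t⁻¹ + r) * Real.exp (-(r * t) / 2) * Real.sinh x := by ring
end
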